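/- arXiv:1211.5450 — 10 statements merged into one kernel-verified Lean document; each statement's English description precedes it below -/
import Mathlib

section
/- Let A be a unital C*-algebra over ℂ, G a finite group, and α : G → Aut(A) an action of G on A by *-automorphisms which has the strict Rokhlin property. Let p ∈ A be a nonzero projection with α_g(p) = p for all g ∈ G. Then the induced action on the corner pAp has the strict Rokhlin property; explicitly: for every finite set F ⊆ pAp and every ε > 0 there exist mutually orthogonal projections e_g ∈ pAp (g ∈ G) with Σ_{g∈G} e_g = p, ‖α_g(e_h) − e_{gh}‖ < ε for all g, h ∈ G, and ‖e_g a − a e_g‖ < ε for all g ∈ G and all a ∈ F. -/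
/-- A projection in a C*-algebra: a self-adjoint idempotent. -/
def IsProjection {A : Type*} [Mul A] [Star A] (p : A) : Prop :=
  star p = p ∧ p * p = p

/-- A positive element of a C*-algebra: an element of the form `star y * y`. -/
def IsPositiveElem {A : Type*} [Mul A] [Star A] (x : A) : Prop :=
  ∃ y, x = star y * y

/-- The hereditary subalgebra `Her x`: the norm-closure of `x A x`. -/
def Her {A : Type*} [Mul A] [TopologicalSpace A] (x : A) : Set A :=
  closure {y | ∃ a, y = x * a * x}

/-- Blackadar subequivalence (specialized to projections): `p ⪯ x` iff there is `v` with
`v * v* = p` and `v* * v ∈ Her x`. -/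
def ProjSubEquiv {A : Type*} [Mul A] [Star A] [TopologicalSpace A] (p x : A) : Prop :=
  ∃ v, v * star v = p ∧ star v * v ∈ Her x

/-- Property (SP): every nonzero positive element has a nonzero projection in its
hereditary subalgebra. -/
def HasSP (A : Type*) [NonUnitalNonAssocSemiring A] [Star A] [TopologicalSpace A] : Prop :=
  ∀ a : A, IsPositiveElem a → a ≠ 0 → ∃ p ∈ Her a, IsProjection p ∧ p ≠ 0

/-- A full positive element: every closed two-sided ideal containing it is all of `A`. -/
def IsFull {A : Type*} [NonUnitalNonAssocRing A] [TopologicalSpace A] (x : A) : Prop :=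
  ∀ I : TwoSidedIdeal A, IsClosed (I : Set A) → x ∈ I → ∀ a : A, a ∈ I

/-- The strict Rokhlin property for an action of a finite group `G` on a unital
C*-algebra `A` by *-automorphisms. -/
def StrictRokhlin {A : Type*} [Ring A] [StarRing A] [Algebra ℂ A] [Norm A]
    {G : Type*} [Group G] [Fintype G] (α : G → A ≃⋆ₐ[ℂ] A) : Prop :=
  ∀ (F : Finset A) (ε : ℝ), 0 < ε →
    ∃ e : G → A, (∀ g, IsProjection (e g)) ∧
      (∀ g h, g ≠ h → e g * e h = 0) ∧
      (∑ g, e g) = 1 ∧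
      (∀ g h, ‖α g (e h) - e (g * h)‖ < ε) ∧
      (∀ g, ∀ a ∈ F, ‖e g * a - a * e g‖ < ε)

/-- The tracial Rokhlin property for an action of a finite group `G` on a unital
C*-algebra `A` by *-automorphisms. -/
def TracialRokhlin {A : Type*} [Ring A] [StarRing A] [Algebra ℂ A] [Norm A]
    [TopologicalSpace A]
    {G : Type*} [Group G] [Fintype G] (α : G → A ≃⋆ₐ[ℂ] A) : Prop :=
  ∀ (F : Finset A) (ε : ℝ), 0 < ε → ∀ x : A, IsPositiveElem x → ‖x‖ = 1 →
    ∃ e : G → A, (∀ g, IsProjection (e g)) ∧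
      (∀ g h, g ≠ h → e g * e h = 0) ∧
      (∀ g h, ‖α g (e h) - e (g * h)‖ < ε) ∧
      (∀ g, ∀ a ∈ F, ‖e g * a - a * e g‖ < ε) ∧
      ProjSubEquiv (1 - ∑ g, e g) x ∧
      ‖(∑ g, e g) * x * (∑ g, e g)‖ > 1 - ε

/-- The weak tracial Rokhlin property for an action of a finite group `G` on a unital
C*-algebra `A` by *-automorphisms. -/
def WeakTracialRokhlin {A : Type*} [Ring A] [StarRing A] [Algebra ℂ A] [Norm A]
    [TopologicalSpace A]
    {G : Type*} [Group G] [Fintype G] (α : G → A ≃⋆ₐ[ℂ] A) : Prop :=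
  ∀ (F : Finset A) (ε : ℝ), 0 < ε →
    ∀ b : A, IsPositiveElem b → ‖b‖ = 1 →
    ∀ x : A, IsPositiveElem x → IsFull x →
    ∃ e : G → A, (∀ g, IsProjection (e g)) ∧
      (∀ g h, g ≠ h → e g * e h = 0) ∧
      (∀ g h, ‖α g (e h) - e (g * h)‖ < ε) ∧
      (∀ g, ∀ a ∈ F, ‖e g * a - a * e g‖ < ε) ∧
      ProjSubEquiv (1 - ∑ g, e g) x ∧
      ‖(∑ g, e g) * b * (∑ g, e g)‖ > 1 - ε

theorem aux_norm_proj {A : Type*} [CStarAlgebra A] {e : A} (h : IsProjection e) : ‖e‖ ≤ 1 := by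
  have h1 : ‖star e * e‖ = ‖e‖ * ‖e‖ := CStarRing.norm_star_mul_self
  rw [h.1, h.2] at h1
  nlinarith [norm_nonneg e]

theorem aux_norm_one {A : Type*} [CStarAlgebra A] : ‖(1 : A)‖ ≤ 1 :=
  aux_norm_proj ⟨star_one A, mul_one 1⟩

theorem aux_norm_iso {A : Type*} [CStarAlgebra A] {s : A} (h : star s * s = 1) : ‖s‖ ≤ 1 := by
  have h1 : ‖star s * s‖ = ‖s‖ * ‖s‖ := CStarRing.norm_star_mul_self
  rw [h] at h1
  nlinarith [norm_nonneg s, aux_norm_one (A := A)]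

theorem aux_invsqrt {A : Type*} [CStarAlgebra A] {b : A} (hb : IsSelfAdjoint b) {δ : ℝ}
    (hδ : δ ≤ 1 / 2) (h : ‖b - 1‖ ≤ δ) :
    ∃ c : A, star c = c ∧ c * c * b = 1 ∧ ‖c - 1‖ ≤ δ ∧ ∀ y, Commute b y → Commute c y := by
  have hδ0 : 0 ≤ δ := (norm_nonneg _).trans h
  have hspec : ∀ x ∈ spectrum ℝ b, |x - 1| ≤ δ := by
    intro x hx
    have h1 : x - 1 ∈ spectrum ℝ (b - algebraMap ℝ A 1) := by
      rw [← spectrum.sub_singleton_eq]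
      exact Set.sub_mem_sub hx rfl
    have h2 := spectrum.norm_le_norm_mul_of_mem h1
    rw [map_one] at h2
    have h3 := aux_norm_one (A := A)
    rw [Real.norm_eq_abs] at h2
    nlinarith [norm_nonneg (b - 1)]
  have hpos : ∀ x ∈ spectrum ℝ b, 1 / 2 ≤ x := by
    intro x hx
    have := (abs_le.1 (hspec x hx)).1
    linarith
  have hcont : ContinuousOn (fun x : ℝ => (√x)⁻¹) (spectrum ℝ b) := by
    apply ContinuousOn.inv₀ (by fun_prop)
    intro x hx
    have := hpos x hx
    exact (Real.sqrt_pos.2 (by linarith)).ne'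
  refine ⟨cfc (fun x : ℝ => (√x)⁻¹) b, ?_, ?_, ?_, ?_⟩
  · exact (cfc_predicate (p := IsSelfAdjoint) (fun x : ℝ => (√x)⁻¹) b).star_eq
  · conv_lhs => rw [← cfc_mul (fun x : ℝ => (√x)⁻¹) (fun x : ℝ => (√x)⁻¹) b hcont hcont]
    nth_rewrite 2 [← cfc_id' ℝ b]
    rw [← cfc_mul (fun x : ℝ => (√x)⁻¹ * (√x)⁻¹) (fun x : ℝ => x) b (hcont.mul hcont)
      continuousOn_id, ← cfc_const_one ℝ b]
    apply cfc_congr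
    intro x hx
    have hx := hpos x hx
    have h1 : √x * √x = x := Real.mul_self_sqrt (by linarith)
    simp only
    rw [← mul_inv, h1, inv_mul_cancel₀ (by linarith)]
  · rw [← cfc_const_one ℝ b, ← cfc_sub (fun x : ℝ => (√x)⁻¹) (fun _ => 1) b hcont continuousOn_const]
    apply norm_cfc_le hδ0
    intro x hx
    have h2 := hspec x hx
    have hx := hpos x hx
    have h1 : √x * √x = x := Real.mul_self_sqrt (by linarith)
    have h3 : 1 / 2 ≤ √x := Real.le_sqrt_of_sq_le (by linarith)
    have h4 : (√x)⁻¹ - 1 = - (x - 1) / (√x * (1 + √x)) := by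
      field_simp
      nlinarith
    rw [h4, Real.norm_eq_abs, abs_div, abs_neg]
    have h5 : 1 ≤ √x * (1 + √x) := by nlinarith
    rw [abs_of_pos (by linarith : 0 < √x * (1 + √x))]
    exact (div_le_self (abs_nonneg _) h5).trans h2
  · intro y hy
    exact hy.cfc_real _

/-- Nearby symmetries are conjugate by a unitary near `1`. -/
theorem aux_unitary {A : Type*} [CStarAlgebra A] {s t : A} (hs : star s = s) (ht : star t = t)
    (hs2 : s * s = 1) (ht2 : t * t = 1) {r : ℝ} (hr : r ≤ 1) (h : ‖t - s‖ ≤ r) :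
    ∃ u : A, star u * u = 1 ∧ u * star u = 1 ∧ u * t = s * u ∧ ‖u - 1‖ ≤ r := by
  have hr0 : 0 ≤ r := (norm_nonneg _).trans h
  have a1 : ∀ x : A, s * (s * x) = x := fun x => by rw [← mul_assoc, hs2, one_mul]
  have a2 : ∀ x : A, t * (t * x) = x := fun x => by rw [← mul_assoc, ht2, one_mul]
  obtain ⟨w, hw⟩ : ∃ w : A, w = (1 / 2 : ℝ) • (1 + s * t) := ⟨_, rfl⟩
  have hws : star w = (1 / 2 : ℝ) • (1 + t * s) := by
    rw [hw]; simp [hs, ht]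
  have hwt : w * t = s * w := by
    simp only [hw, smul_mul_assoc, mul_smul_comm, add_mul, mul_add, mul_assoc, ht2, a1, one_mul,
      mul_one]
    rw [add_comm]
  have hb : star w * w = 1 - (1 / 4 : ℝ) • ((t - s) * (t - s)) := by
    rw [hws]
    simp only [hw, smul_mul_assoc, mul_smul_comm, add_mul, mul_add, sub_mul, mul_sub,
      mul_assoc, ht2, a1, a2, hs2, one_mul, mul_one]
    module
  have hb' : w * star w = star w * w := by
    rw [hws]
    simp only [hw, smul_mul_assoc, mul_smul_comm, add_mul, mul_add, sub_mul, mul_sub,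
      mul_assoc, ht2, a1, a2, hs2, one_mul, mul_one]
    module
  have hbt : Commute (star w * w) t := by
    rw [hb]
    simp only [Commute, SemiconjBy, smul_mul_assoc, mul_smul_comm, add_mul, mul_add, sub_mul,
      mul_sub, mul_assoc, ht2, a1, a2, hs2, one_mul, mul_one]
    module
  have hbw : Commute (star w * w) w := by
    show star w * w * w = w * (star w * w)
    rw [← mul_assoc, hb']
  have hn : ‖star w * w - 1‖ ≤ r / 4 := by
    have e : star w * w - 1 = -((1 / 4 : ℝ) • ((t - s) * (t - s))) := by rw [hb]; abel
    rw [e, norm_neg, norm_smul]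
    have := norm_mul_le (t - s) (t - s)
    have h0 := norm_nonneg (t - s)
    norm_num
    nlinarith
  have hwn : ‖w - 1‖ ≤ r / 2 := by
    have e : w - 1 = (1 / 2 : ℝ) • (s * (t - s)) := by
      rw [hw, mul_sub, hs2]; module
    rw [e, norm_smul]
    have := norm_mul_le s (t - s)
    have h0 := norm_nonneg (t - s)
    have h1 : ‖s‖ ≤ 1 := aux_norm_iso (by rw [hs, hs2])
    norm_num
    nlinarith
  obtain ⟨d, hd, hdb, hdn, hdc⟩ := aux_invsqrt (IsSelfAdjoint.star_mul_self w)
    (by linarith : r / 4 ≤ 1 / 2) hn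
  have hdw : d * w = w * d := hdc w hbw
  have hdt : d * t = t * d := hdc t hbt
  have hdB : d * (star w * w) = (star w * w) * d := hdc _ rfl
  refine ⟨w * d, ?_, ?_, ?_, ?_⟩
  · rw [star_mul, hd]
    calc d * star w * (w * d) = d * ((star w * w) * d) := by noncomm_ring
      _ = 1 := by rw [← hdB, ← mul_assoc, hdb]
  · rw [star_mul, hd, ← hdw]
    calc d * w * (d * star w) = d * (w * d) * star w := by noncomm_ring
      _ = d * d * (w * star w) := by rw [← hdw]; noncomm_ring
      _ = 1 := by rw [hb', hdb]
  · rw [mul_assoc, hdt, ← mul_assoc, hwt, mul_assoc]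
  · have e : w * d - 1 = (w - 1) * (d - 1) + (w - 1) + (d - 1) := by noncomm_ring
    rw [e]
    have h1 := norm_add₃_le (a := (w - 1) * (d - 1)) (b := w - 1) (c := d - 1)
    have h2 := norm_mul_le (w - 1) (d - 1)
    have h3 : ‖w - 1‖ * ‖d - 1‖ ≤ (r / 2) * (r / 4) :=
      mul_le_mul hwn hdn (norm_nonneg _) (by linarith)
    nlinarith

/-- A symmetry nearly commuting with a partition of unity is close to one that commutes. -/
theorem aux_sym {A : Type*} [CStarAlgebra A] {G : Type*} [Fintype G]
    {s : A} (hs : star s = s) (hs2 : s * s = 1) {e : G → A} (he : ∀ g, IsProjection (e g))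
    (horth : ∀ g h, g ≠ h → e g * e h = 0) (hsum : ∑ g, e g = 1)
    {δ η : ℝ} (hδ : ∀ g, ‖e g * s - s * e g‖ ≤ δ) (hη : Fintype.card G * δ ≤ η)
    (hη1 : η ≤ 1 / 6) :
    ∃ t : A, star t = t ∧ t * t = 1 ∧ (∀ g, t * e g = e g * t) ∧ ‖t - s‖ ≤ 7 * η := by
  classical
  have hsn : ‖s‖ ≤ 1 := aux_norm_iso (by rw [hs, hs2])
  obtain ⟨y, hy⟩ : ∃ y : A, y = ∑ g, e g * s * e g := ⟨_, rfl⟩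
  have hys : star y = y := by
    rw [hy, star_sum]
    refine Finset.sum_congr rfl fun g _ => ?_
    rw [star_mul, star_mul, hs, (he g).1, mul_assoc]
  have hye : ∀ g, y * e g = e g * s * e g := by
    intro g
    rw [hy, Finset.sum_mul, Finset.sum_eq_single g]
    · rw [mul_assoc, (he g).2]
    · intro h _ hne
      rw [mul_assoc, horth h g hne, mul_zero]
    · simp
  have hey : ∀ g, e g * y = e g * s * e g := by
    intro g
    rw [hy, Finset.mul_sum, Finset.sum_eq_single g]
    · rw [← mul_assoc, ← mul_assoc, (he g).2]
    · intro h _ hne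
      rw [← mul_assoc, ← mul_assoc, horth g h hne.symm, zero_mul, zero_mul]
    · simp
  have hyn : ‖y - s‖ ≤ η := by
    have e1 : y - s = ∑ g, -(e g * (e g * s - s * e g)) := by
      have : s = ∑ g, e g * s := by rw [← Finset.sum_mul, hsum, one_mul]
      conv_lhs => rw [this, hy, ← Finset.sum_sub_distrib]
      refine Finset.sum_congr rfl fun g _ => ?_
      rw [mul_sub, ← mul_assoc, (he g).2, mul_assoc]
      abel
    rw [e1]
    refine (norm_sum_le_of_le _ (f := fun g => -(e g * (e g * s - s * e g))) (n := fun _ => δ) ?_).trans ?_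
    · intro g _
      rw [norm_neg]
      refine (norm_mul_le _ _).trans ?_
      have := aux_norm_proj (he g)
      nlinarith [norm_nonneg (e g * s - s * e g), hδ g]
    · simpa using hη
  have hη0 : 0 ≤ η := (norm_nonneg _).trans hyn
  have hyn1 : ‖y‖ ≤ 1 + η := by
    have := norm_add_le (y - s) s
    rw [sub_add_cancel] at this
    linarith
  have hyy : ‖y * y - 1‖ ≤ 3 * η := by
    have e1 : y * y - 1 = y * (y - s) + (y - s) * s := by
      rw [mul_sub, sub_mul, hs2]; abel
    rw [e1]
    have h1 := norm_add_le (y * (y - s)) ((y - s) * s)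
    have h2 := norm_mul_le y (y - s)
    have h3 := norm_mul_le (y - s) s
    have h4 : ‖y‖ * ‖y - s‖ ≤ (1 + η) * η := mul_le_mul hyn1 hyn (norm_nonneg _) (by linarith)
    have h5 : ‖y - s‖ * ‖s‖ ≤ η * 1 := mul_le_mul hyn hsn (norm_nonneg _) hη0
    nlinarith
  have hsa : IsSelfAdjoint (y * y) := by
    show star (y * y) = y * y
    rw [star_mul, hys]
  obtain ⟨c, hc, hcb, hcn, hcc⟩ := aux_invsqrt hsa (by linarith : 3 * η ≤ 1 / 2) hyy
  have hcy : c * y = y * c := hcc y (by show y * y * y = y * (y * y); rw [mul_assoc])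
  have hce : ∀ g, c * e g = e g * c := fun g => hcc _ (by
    have hg : Commute y (e g) := (hye g).trans (hey g).symm
    exact hg.mul_left hg)
  refine ⟨y * c, ?_, ?_, ?_, ?_⟩
  · rw [star_mul, hc, hys, hcy]
  · rw [← hcb]
    calc y * c * (y * c) = (y * c) * y * c := by noncomm_ring
      _ = c * (y * y) * c := by rw [← hcy]; noncomm_ring
      _ = c * y * (y * c) := by noncomm_ring
      _ = c * y * (c * y) := by rw [← hcy]
      _ = c * (y * c) * y := by noncomm_ring
      _ = c * c * (y * y) := by rw [← hcy]; noncomm_ring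
  · intro g
    rw [mul_assoc, hce, ← mul_assoc, hye, ← hey, mul_assoc]
  · have e1 : y * c - s = y * (c - 1) + (y - s) := by noncomm_ring
    rw [e1]
    have h1 := norm_add_le (y * (c - 1)) (y - s)
    have h2 := norm_mul_le y (c - 1)
    have h4 : ‖y‖ * ‖c - 1‖ ≤ (1 + η) * (3 * η) :=
      mul_le_mul hyn1 hcn (norm_nonneg _) (by linarith)
    nlinarith

/-- Perturb a partition of unity nearly commuting with a symmetry to one commuting with it. -/
theorem aux_perturb {A : Type*} [CStarAlgebra A] {G : Type*} [Fintype G]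
    {s : A} (hs : star s = s) (hs2 : s * s = 1) {e : G → A} (he : ∀ g, IsProjection (e g))
    (horth : ∀ g h, g ≠ h → e g * e h = 0) (hsum : ∑ g, e g = 1)
    {δ η : ℝ} (hδ : ∀ g, ‖e g * s - s * e g‖ ≤ δ) (hη : Fintype.card G * δ ≤ η)
    (hη1 : η ≤ 1 / 7) :
    ∃ E : G → A, (∀ g, IsProjection (E g)) ∧ (∀ g h, g ≠ h → E g * E h = 0) ∧ ∑ g, E g = 1 ∧
      (∀ g, s * E g = E g * s) ∧ ∀ g, ‖E g - e g‖ ≤ 14 * η := by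
  obtain ⟨t, ht, ht2, hte, htn⟩ := aux_sym hs hs2 he horth hsum hδ hη (by linarith)
  obtain ⟨u, hu1, hu2, hut, hun⟩ := aux_unitary hs ht hs2 ht2 (by linarith : 7 * η ≤ 1) htn
  have hus : star u * s = t * star u := by
    have := congrArg star hut
    rw [star_mul, star_mul, hs, ht] at this
    exact this.symm
  have key : ∀ x z : A, (u * x * star u) * (u * z * star u) = u * (x * z) * star u := by
    intro x z
    calc (u * x * star u) * (u * z * star u) = u * x * (star u * u) * (z * star u) := by
          noncomm_ring
      _ = _ := by rw [hu1]; noncomm_ring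
  refine ⟨fun g => u * e g * star u, ?_, ?_, ?_, ?_, ?_⟩
  · intro g
    refine ⟨?_, ?_⟩
    · simp only [star_mul, star_star, (he g).1, mul_assoc]
    · rw [key, (he g).2]
  · intro g h hne
    simp only
    rw [key, horth g h hne, mul_zero, zero_mul]
  · rw [← Finset.sum_mul, ← Finset.mul_sum, hsum, mul_one, hu2]
  · intro g
    simp only
    calc s * (u * e g * star u) = (s * u) * e g * star u := by noncomm_ring
      _ = u * (t * e g) * star u := by rw [← hut]; noncomm_ring
      _ = u * e g * (t * star u) := by rw [hte]; noncomm_ring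
      _ = _ := by rw [← hus]; noncomm_ring
  · intro g
    simp only
    have e1 : u * e g * star u - e g = (u - 1) * e g * star u + e g * star (u - 1) := by
      rw [star_sub, star_one]; noncomm_ring
    rw [e1]
    have hsu : ‖star u‖ ≤ 1 := aux_norm_iso (by rw [star_star, hu2])
    have heg := aux_norm_proj (he g)
    have h1 := norm_add_le ((u - 1) * e g * star u) (e g * star (u - 1))
    have h2 : ‖(u - 1) * e g * star u‖ ≤ 7 * η * 1 * 1 :=
      norm_mul_le_of_le (norm_mul_le_of_le hun heg) hsu
    have h3 : ‖e g * star (u - 1)‖ ≤ 1 * (7 * η) :=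
      norm_mul_le_of_le heg (by rw [norm_star]; exact hun)
    linarith

/-- A strict Rokhlin action restricts to a strict Rokhlin action on the corner
`pAp` of an invariant nonzero projection `p`. -/
theorem stmt0 {A : Type*} [CStarAlgebra A] {G : Type*} [Group G] [Fintype G]
    (α : G → A ≃⋆ₐ[ℂ] A)
    (hα1 : ∀ a : A, α 1 a = a)
    (hαmul : ∀ (g h : G) (a : A), α (g * h) a = α g (α h a))
    (hRok : StrictRokhlin α)
    (p : A) (hp : IsProjection p) (hp0 : p ≠ 0)
    (hpinv : ∀ g : G, α g p = p) :
    ∀ F : Finset A, (∀ a ∈ F, p * a * p = a) → ∀ ε : ℝ, 0 < ε →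
      ∃ e : G → A,
        (∀ g, IsProjection (e g) ∧ p * e g * p = e g) ∧
        (∀ g h, g ≠ h → e g * e h = 0) ∧
        (∑ g, e g) = p ∧
        (∀ g h, ‖α g (e h) - e (g * h)‖ < ε) ∧
        (∀ g, ∀ a ∈ F, ‖e g * a - a * e g‖ < ε) := by
  classical
  intro F hF ε hε
  obtain ⟨M, hM1, hM⟩ : ∃ M : ℝ, 1 ≤ M ∧ ∀ a ∈ F, ‖a‖ ≤ M := by
    refine ⟨1 + ∑ a ∈ F, ‖a‖, ?_, ?_⟩
    · have : 0 ≤ ∑ a ∈ F, ‖a‖ := Finset.sum_nonneg fun _ _ => norm_nonneg _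
      linarith
    · intro a ha
      have := Finset.single_le_sum (f := fun a : A => ‖a‖) (fun _ _ => norm_nonneg _) ha
      linarith
  obtain ⟨η, hη0, hη1, hηε⟩ : ∃ η : ℝ, 0 < η ∧ η ≤ 1 / 7 ∧ 28 * η * M ≤ ε / 2 := by
    refine ⟨min (1 / 7) (ε / (56 * M)), lt_min (by norm_num) (by positivity), min_le_left _ _, ?_⟩
    have h1 : min (1 / 7) (ε / (56 * M)) ≤ ε / (56 * M) := min_le_right _ _
    rw [le_div_iff₀ (by positivity)] at h1
    linarith
  have hcard : (0 : ℝ) < Fintype.card G := by exact_mod_cast Fintype.card_pos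
  obtain ⟨δ, hδ0, hδη, hδε⟩ : ∃ δ : ℝ, 0 < δ ∧ Fintype.card G * (2 * δ) ≤ η ∧ δ ≤ ε / 2 := by
    refine ⟨min (ε / 2) (η / (2 * Fintype.card G)), lt_min (by positivity) (by positivity), ?_,
      min_le_left _ _⟩
    have h1 : min (ε / 2) (η / (2 * Fintype.card G)) ≤ η / (2 * Fintype.card G) :=
      min_le_right _ _
    rw [le_div_iff₀ (by positivity)] at h1
    linarith
  obtain ⟨e, he, horth, hsum, hact, hcomm⟩ := hRok (insert p F) δ hδ0
  obtain ⟨hp1, hp2⟩ := hp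
  have hpn : ‖p‖ ≤ 1 := aux_norm_proj ⟨hp1, hp2⟩
  obtain ⟨E, hE, hEorth, hEsum, hEs, hEn⟩ := aux_perturb (s := p + p - 1)
    (by simp [hp1]) (by simp only [add_mul, mul_add, sub_mul, mul_sub, hp2, one_mul, mul_one]; abel)
    he horth hsum (δ := 2 * δ) (η := η) (by
      intro g
      have e1 : e g * (p + p - 1) - (p + p - 1) * e g
        = (e g * p - p * e g) + (e g * p - p * e g) := by noncomm_ring
      rw [e1]
      have h1 := hcomm g p (Finset.mem_insert_self _ _)
      have h2 := norm_add_le (e g * p - p * e g) (e g * p - p * e g)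
      linarith) hδη hη1
  have hEp : ∀ g, p * E g = E g * p := by
    intro g
    have h1 := hEs g
    have h2 : (2 : ℂ) • (p * E g) = (2 : ℂ) • (E g * p) := by
      rw [sub_mul, mul_sub, one_mul, mul_one, add_mul, mul_add] at h1
      rw [two_smul, two_smul]
      exact sub_left_injective h1
    exact smul_right_injective A (two_ne_zero : (2 : ℂ) ≠ 0) h2
  have hη' : 28 * η ≤ ε / 2 := by nlinarith
  refine ⟨fun g => E g * p, ?_, ?_, ?_, ?_, ?_⟩
  · intro g
    refine ⟨⟨?_, ?_⟩, ?_⟩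
    · simp only [star_mul, hp1, (hE g).1, hEp]
    · calc E g * p * (E g * p) = E g * (p * E g) * p := by noncomm_ring
        _ = (E g * E g) * (p * p) := by rw [hEp]; noncomm_ring
        _ = E g * p := by rw [(hE g).2, hp2]
    · calc p * (E g * p) * p = (p * E g) * (p * p) := by noncomm_ring
        _ = E g * (p * p) := by rw [hEp, hp2, mul_assoc, hp2]
        _ = E g * p := by rw [hp2]
  · intro g h hne
    calc E g * p * (E h * p) = E g * (p * E h) * p := by noncomm_ring
      _ = (E g * E h) * (p * p) := by rw [hEp]; noncomm_ring
      _ = 0 := by rw [hEorth g h hne, zero_mul]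
  · rw [← Finset.sum_mul, hEsum, one_mul]
  · intro g h
    simp only
    have e1 : α g (E h * p) - E (g * h) * p
        = (α g (E h - e h) + (α g (e h) - e (g * h)) + -(E (g * h) - e (g * h))) * p := by
      rw [map_mul, hpinv, map_sub]; noncomm_ring
    rw [e1]
    have h1 : ‖α g (E h - e h)‖ ≤ 14 * η := by
      rw [StarAlgEquiv.norm_map]; exact hEn h
    have h2 := hact g h
    have h3 : ‖-(E (g * h) - e (g * h))‖ ≤ 14 * η := by rw [norm_neg]; exact hEn _
    have h4 := norm_add₃_le (a := α g (E h - e h)) (b := α g (e h) - e (g * h))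
      (c := -(E (g * h) - e (g * h)))
    have h5 := norm_mul_le_of_le (le_refl
      ‖α g (E h - e h) + (α g (e h) - e (g * h)) + -(E (g * h) - e (g * h))‖) hpn
    linarith
  · intro g a ha
    simp only
    have hpa : p * a = a := by
      rw [← hF a ha, ← mul_assoc, ← mul_assoc, hp2]
    have hap : a * p = a := by
      rw [← hF a ha, mul_assoc, hp2]
    have e1 : E g * p * a - a * (E g * p)
        = (E g - e g) * a + (e g * a - a * e g) + -(a * (E g - e g)) := by
      rw [← hEp, ← mul_assoc a, hap, hEp, mul_assoc, hpa]; noncomm_ring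
    rw [e1]
    have h2 := hcomm g a (Finset.mem_insert_of_mem ha)
    have h1 : ‖(E g - e g) * a‖ ≤ 14 * η * M := norm_mul_le_of_le (hEn g) (hM a ha)
    have h3 : ‖-(a * (E g - e g))‖ ≤ M * (14 * η) := by
      rw [norm_neg]; exact norm_mul_le_of_le (hM a ha) (hEn g)
    have h4 := norm_add₃_le (a := (E g - e g) * a) (b := e g * a - a * e g)
      (c := -(a * (E g - e g)))
    linarith
end

section
/- Let A be a unital C*-algebra over ℂ, G a finite group, and α : G → Aut(A) an action by *-automorphisms. Suppose (A_n) is an increasing sequence of closed unital *-subalgebras of A with α_g(A_n) = A_n for all g ∈ G and n, and with ⋃_n A_n dense in A. If for every n the restricted action on A_n has the strict Rokhlin property (with Rokhlin projections taken in A_n), then α has the strict Rokhlin property on A. -/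
/-- An inductive limit of actions with the strict Rokhlin property has the
strict Rokhlin property. -/
theorem stmt1 {A : Type*} [CStarAlgebra A] {G : Type*} [Group G] [Fintype G]
    (α : G → A ≃⋆ₐ[ℂ] A)
    (hα1 : ∀ a : A, α 1 a = a)
    (hαmul : ∀ (g h : G) (a : A), α (g * h) a = α g (α h a))
    (S : ℕ → StarSubalgebra ℂ A)
    (hclosed : ∀ n, IsClosed (S n : Set A))
    (hmono : Monotone S)
    (hinv : ∀ (g : G) (n : ℕ), (α g) '' (S n : Set A) = (S n : Set A))
    (hdense : Dense (⋃ n, (S n : Set A)))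
    (hRok : ∀ (n : ℕ) (F : Finset A), (F : Set A) ⊆ (S n : Set A) → ∀ ε : ℝ, 0 < ε →
      ∃ e : G → A, (∀ g, e g ∈ S n) ∧ (∀ g, IsProjection (e g)) ∧
        (∀ g h, g ≠ h → e g * e h = 0) ∧
        (∑ g, e g) = 1 ∧
        (∀ g h, ‖α g (e h) - e (g * h)‖ < ε) ∧
        (∀ g, ∀ a ∈ F, ‖e g * a - a * e g‖ < ε)) :
    StrictRokhlin α := by
  classical
  intro F ε hε
  have happ : ∀ a : A, ∃ n : ℕ, ∃ b ∈ S n, ‖a - b‖ < ε / 4 := by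
    intro a
    obtain ⟨b, hb, hab⟩ := hdense.exists_dist_lt a (show 0 < ε / 4 by linarith)
    obtain ⟨n, hn⟩ := Set.mem_iUnion.1 hb
    exact ⟨n, b, hn, by rwa [← dist_eq_norm]⟩
  choose n f hf hfa using happ
  obtain ⟨e, -, hp, ho, hs, hg, hc⟩ := hRok (F.sup n) (F.image f) (by
    intro x hx
    obtain ⟨a, ha, rfl⟩ := Finset.mem_image.1 (Finset.mem_coe.1 hx)
    exact hmono (Finset.le_sup ha) (hf a)) (ε / 4) (by linarith)
  refine ⟨e, hp, ho, hs, fun g h => (hg g h).trans (by linarith), fun g a ha => ?_⟩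
  have he : ‖e g‖ ≤ 1 := by
    have h1 : ‖e g‖ = ‖e g‖ * ‖e g‖ := by
      have h2 := CStarRing.norm_star_mul_self (x := e g)
      rwa [(hp g).1, (hp g).2] at h2
    nlinarith [norm_nonneg (e g)]
  have hb := hc g (f a) (Finset.mem_image_of_mem f ha)
  have hd := hfa a
  have h1 : ‖e g * (a - f a)‖ ≤ ‖a - f a‖ :=
    (norm_mul_le _ _).trans (mul_le_of_le_one_left (norm_nonneg _) he)
  have h2 : ‖(a - f a) * e g‖ ≤ ‖a - f a‖ :=
    (norm_mul_le _ _).trans (mul_le_of_le_one_right (norm_nonneg _) he)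
  have h3 : e g * a - a * e g =
      (e g * f a - f a * e g) + e g * (a - f a) - (a - f a) * e g := by
    noncomm_ring
  rw [h3]
  have h4 := norm_sub_le ((e g * f a - f a * e g) + e g * (a - f a)) ((a - f a) * e g)
  have h5 := norm_add_le (e g * f a - f a * e g) (e g * (a - f a))
  linarith
end

section
/- Let A be an infinite-dimensional simple separable unital C*-algebra over ℂ, G a finite group, and α : G → Aut(A) an action by *-automorphisms. Suppose (A_n) is an increasing sequence of closed unital *-subalgebras of A, each infinite-dimensional, simple and separable as a C*-algebra, with α_g(A_n) = A_n for all g ∈ G and n, and with ⋃_n A_n dense in A. If for every n the restricted action on A_n has the tracial Rokhlin property (with all projections and the subequivalence taken in A_n), then α has the tracial Rokhlin property on A. -/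
/-- Rotating a projection approximately fixed by `k x` into `x A x`. -/
lemma aux_rotate {A : Type*} [CStarAlgebra A] (x k q : A) (hx : star x = x)
    (hq : IsProjection q) (hk : ‖k * x * q - q‖ ≤ 1 / 4) :
    ∃ u b : A, star u * u = q ∧ u * star u = x * b * x := by
  let _ : PartialOrder A := CStarAlgebra.spectralOrder A
  have : StarOrderedRing A := CStarAlgebra.spectralOrderedRing A
  obtain ⟨hq1, hq2⟩ := hq
  have hqn : ‖q‖ ≤ 1 := IsStarProjection.norm_le q ⟨hq2, hq1⟩
  set r := k * x * q with hr
  have hp : (0 : A) ≤ 1 - q := by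
    have h := star_mul_self_nonneg (1 - q)
    have e : star (1 - q) * (1 - q) = 1 - q := by
      rw [star_sub, star_one, hq1, mul_sub, sub_mul, sub_mul, hq2]; simp
    rwa [e] at h
  have hrn : ‖r‖ ≤ 5 / 4 := by
    calc ‖r‖ = ‖(r - q) + q‖ := by simp
      _ ≤ ‖r - q‖ + ‖q‖ := norm_add_le _ _
      _ ≤ 5 / 4 := by linarith
  have hrr : ‖star r * r - q‖ < 1 := by
    have e : star r * r - q = star r * (r - q) + star (r - q) * q := by
      rw [star_sub, hq1, mul_sub, sub_mul, hq2]; abel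
    rw [e]
    calc _ ≤ ‖star r‖ * ‖r - q‖ + ‖star (r - q)‖ * ‖q‖ :=
          (norm_add_le _ _).trans (add_le_add (norm_mul_le _ _) (norm_mul_le _ _))
      _ ≤ 5 / 4 * (1 / 4) + 1 / 4 * 1 := by
          rw [norm_star, norm_star]; gcongr
      _ < 1 := by norm_num
  set M := star (x * q) * (x * q) + (1 - q) with hM
  have hM0 : 0 ≤ M := add_nonneg (star_mul_self_nonneg _) hp
  have hU : IsUnit (star r * r + (1 - q)) := by
    have := (Units.oneSub (-(star r * r - q)) (by rwa [norm_neg])).isUnit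
    convert this using 1
    simp only [Units.val_oneSub]; abel
  set K : ℝ := ‖k‖ ^ 2 + 1 with hK
  have hKpos : 0 < K := by positivity
  have hle : star r * r + (1 - q) ≤ K • M := by
    have h1 : star k * k ≤ algebraMap ℝ A (‖k‖ ^ 2) := CStarAlgebra.star_mul_le_algebraMap_norm_sq
    have h2 := star_left_conjugate_le_conjugate h1 (x * q)
    have e1 : star (x * q) * (star k * k) * (x * q) = star r * r := by
      simp only [hr, star_mul, mul_assoc]
    have e2 : star (x * q) * algebraMap ℝ A (‖k‖ ^ 2) * (x * q)
        = (‖k‖ ^ 2) • (star (x * q) * (x * q)) := by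
      rw [Algebra.algebraMap_eq_smul_one, mul_smul_comm, mul_one, smul_mul_assoc]
    rw [e1, e2] at h2
    have e3 : K • M = (‖k‖ ^ 2) • (star (x * q) * (x * q)) + (1 - q)
        + (star (x * q) * (x * q) + ‖k‖ ^ 2 • (1 - q)) := by
      rw [hK, hM]; module
    rw [e3]
    refine (add_le_add_left h2 _).trans (le_add_of_nonneg_right ?_)
    exact add_nonneg (star_mul_self_nonneg _) (smul_nonneg (by positivity) hp)
  have hKM : IsUnit (K • M) :=
    CStarAlgebra.isUnit_of_le _ hle (hU.isStrictlyPositive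
      (add_nonneg (star_mul_self_nonneg _) hp))
  have hMu : IsUnit M := by
    have := hKM
    rw [show K • M = (algebraMap ℝ A K) * M from Algebra.smul_def K M] at this
    have hKu : IsUnit (algebraMap ℝ A K) := (IsUnit.mk0 K hKpos.ne').map (algebraMap ℝ A)
    exact (hKu.mul_left_iff).1 this
  have hMs : IsStrictlyPositive M := hMu.isStrictlyPositive hM0
  have hpM : (1 - q) * M = 1 - q := by
    rw [hM, star_mul, hq1]
    have : (1 - q) * q = 0 := by rw [sub_mul, hq2]; simp
    simp only [mul_add, ← mul_assoc, this, zero_mul]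
    simp [mul_sub, sub_mul, hq2]
  have hMp : M * (1 - q) = 1 - q := by
    have := congrArg star hpM
    rw [star_mul, hM0.isSelfAdjoint.star_eq, star_sub, star_one, hq1] at this
    exact this
  have hcomm : Commute M (1 - q) := by rw [Commute, SemiconjBy, hpM, hMp]
  set c := M ^ (-(1 / 2) : ℝ) with hc
  have hccomm : Commute c (1 - q) := by
    rw [hc, CFC.rpow_def]
    exact hcomm.cfc_nnreal _
  have hcs : star c = c := (CFC.rpow_nonneg (a := M)).isSelfAdjoint.star_eq
  have hcMc : c * M * c = 1 := CFC.conjugate_rpow_neg_one_half M hMs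
  have hcpc : c * (1 - q) * c = 1 - q := by
    have h3 : (1 - q) * (c * M * c) = 1 - q := by rw [hcMc, mul_one]
    calc c * (1 - q) * c = c * (M * (1 - q)) * c := by rw [hMp]
      _ = c * (M * ((1 - q) * c)) := by simp only [mul_assoc]
      _ = c * (M * (c * (1 - q))) := by rw [hccomm.eq]
      _ = (c * M * c) * (1 - q) := by simp only [mul_assoc]
      _ = 1 - q := by rw [hcMc, one_mul]
  refine ⟨x * q * c, q * c * c * q, ?_, ?_⟩
  · have : star (x * q * c) * (x * q * c) = c * M * c - c * (1 - q) * c := by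
      rw [star_mul, hcs, hM]
      noncomm_ring
    rw [this, hcMc, hcpc]; abel
  · simp only [star_mul, hx, hq1, hcs, mul_assoc]

/-- The functional calculus elements needed from a norm one positive element. -/
lemma aux_cut {A : Type*} [CStarAlgebra A] (T : StarSubalgebra ℂ A) (hT : IsClosed (T : Set A))
    (z : A) (hz : z ∈ T) (hn : ‖star z * z‖ = 1) (δ : ℝ) (hδ : 0 < δ) (hδ1 : δ < 1) :
    ∃ w k : A, w ∈ T ∧ ‖star w * w‖ = 1 ∧ ‖star z * z - star w * w‖ ≤ δ ∧ ‖k‖ ≤ 1 / δ ∧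
      k * (star z * z) * (star w * w) = star w * w := by
  let _ : PartialOrder A := CStarAlgebra.spectralOrder A
  have : StarOrderedRing A := CStarAlgebra.spectralOrderedRing A
  set x := star z * z with hx
  have hxT : x ∈ T := mul_mem (star_mem hz) hz
  have hx0 : 0 ≤ x := star_mul_self_nonneg z
  have hxs : IsSelfAdjoint x := hx0.isSelfAdjoint
  have : Nontrivial A := ⟨⟨x, 0, by rintro h; rw [h] at hn; simp at hn⟩⟩
  have h1 : (1 : ℝ) ∈ spectrum ℝ x := by
    have := CStarAlgebra.norm_mem_spectrum_of_nonneg hx0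
    rwa [hn] at this
  have hsp : ∀ t ∈ spectrum ℝ x, 0 ≤ t ∧ t ≤ 1 := by
    intro t ht
    refine ⟨spectrum_nonneg_of_nonneg hx0 ht, ?_⟩
    have := spectrum.norm_le_norm_of_mem ht
    rw [hn] at this
    exact (le_abs_self t).trans this
  have hd : 0 < 1 - δ := by linarith
  let f : ℝ → ℝ := fun t => max (t - δ) 0 / (1 - δ)
  let s : ℝ → ℝ := fun t => Real.sqrt (f t)
  let h : ℝ → ℝ := fun t => (max t δ)⁻¹
  have hf : Continuous f := by fun_prop
  have hs : Continuous s := by fun_prop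
  have hh : Continuous h := by
    refine Continuous.inv₀ (by fun_prop) fun t => ?_
    exact (lt_of_lt_of_le hδ (le_max_right _ _)).ne'
  have hf0 : ∀ t, 0 ≤ f t := fun t => div_nonneg (le_max_right _ _) hd.le
  have hf1 : ∀ t, t ≤ 1 → f t ≤ 1 := fun t ht => by
    rw [div_le_one hd]; exact max_le (by linarith) hd.le
  have hw : star (cfc s x) * cfc s x = cfc f x := by
    rw [(cfc_predicate s x : IsSelfAdjoint _).star_eq, ← cfc_mul s s x hs.continuousOn hs.continuousOn]
    congr 1; funext t; exact Real.mul_self_sqrt (hf0 t)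
  have hid : cfc (fun t : ℝ => t) x = x := cfc_id' ℝ x
  refine ⟨cfc s x, cfc h x, ?_, ?_, ?_, ?_, ?_⟩
  · have : IsClosed (T : Set A) := hT
    exact cfc_mem (𝕜' := ℂ) s hxT
  · rw [hw]
    apply le_antisymm
    · refine norm_cfc_le zero_le_one fun t ht => ?_
      rw [Real.norm_of_nonneg (hf0 t)]; exact hf1 t (hsp t ht).2
    · have := norm_apply_le_norm_cfc f x h1 hf.continuousOn
      have e : f 1 = 1 := by
        simp only [f]; rw [max_eq_left hd.le, div_self hd.ne']
      rwa [e, norm_one] at this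
  · rw [hw]
    nth_rewrite 1 [← hid]
    rw [← cfc_sub (fun t : ℝ => t) f x continuousOn_id hf.continuousOn]
    refine norm_cfc_le hδ.le fun t ht => ?_
    obtain ⟨ht0, ht1⟩ := hsp t ht
    rw [Real.norm_eq_abs, abs_le]
    simp only [f]
    rcases le_total t δ with htd | htd
    · rw [max_eq_right (by linarith)]; simp only [zero_div]; constructor <;> linarith
    · rw [max_eq_left (by linarith)]
      have : t - (t - δ) / (1 - δ) = δ * (1 - t) / (1 - δ) := by field_simp; ring
      rw [this]
      constructor
      · have : 0 ≤ δ * (1 - t) / (1 - δ) := by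
          apply div_nonneg (mul_nonneg hδ.le (by linarith)) hd.le
        linarith
      · rw [div_le_iff₀ hd]; nlinarith
  · refine norm_cfc_le (by positivity) fun t ht => ?_
    rw [Real.norm_of_nonneg (inv_nonneg.2 (hδ.le.trans (le_max_right _ _))), one_div]
    exact inv_anti₀ hδ (le_max_right _ _)
  · rw [hw]
    nth_rewrite 2 [← hid]
    rw [← cfc_mul h (fun t => t) x hh.continuousOn continuousOn_id,
      ← cfc_mul (fun t => h t * t) f x (hh.mul continuous_id).continuousOn hf.continuousOn]
    refine cfc_congr fun t ht => ?_
    simp only [f, h]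
    rcases le_total t δ with htd | htd
    · rw [max_eq_right (show t - δ ≤ 0 by linarith)]; simp
    · rw [max_eq_left htd, inv_mul_cancel₀ (by linarith), one_mul]

lemma aux_approx {A : Type*} [CStarAlgebra A] (S : ℕ → StarSubalgebra ℂ A) (hmono : Monotone S)
    (hdense : Dense (⋃ n, (S n : Set A))) (F : Finset A) (ε : ℝ) (hε : 0 < ε) :
    ∃ (N : ℕ) (φ : A → A), ∀ a ∈ F, φ a ∈ S N ∧ ‖a - φ a‖ < ε := by
  have key : ∀ a : A, ∃ n, ∃ b ∈ S n, ‖a - b‖ < ε := by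
    intro a
    obtain ⟨b, hb, hd⟩ := hdense.exists_dist_lt a hε
    obtain ⟨n, hn⟩ := Set.mem_iUnion.1 hb
    exact ⟨n, b, hn, by rwa [dist_eq_norm] at hd⟩
  choose n φ h1 h2 using key
  exact ⟨F.sup n, φ, fun a ha => ⟨hmono (Finset.le_sup (f := n) ha) (h1 a), h2 a⟩⟩

lemma aux_approx_pos {A : Type*} [CStarAlgebra A] (S : ℕ → StarSubalgebra ℂ A)
    (hdense : Dense (⋃ n, (S n : Set A))) (y : A) (hy : ‖star y * y‖ = 1) (η : ℝ) (hη : 0 < η) :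
    ∃ (n : ℕ) (z : A), z ∈ S n ∧ ‖star z * z‖ = 1 ∧ ‖star y * y - star z * z‖ < η := by
  have hy1 : ‖y‖ = 1 := by
    rw [CStarRing.norm_star_mul_self] at hy; nlinarith [norm_nonneg y]
  let Φ : A → A := fun z => (((‖z‖⁻¹ : ℝ) : ℂ)) • z
  have hΦy : Φ y = y := by simp [Φ, hy1]
  have hΦ : ContinuousAt Φ y := by
    refine ContinuousAt.smul ?_ continuousAt_id
    refine Complex.continuous_ofReal.continuousAt.comp ?_
    exact continuous_norm.continuousAt.inv₀ (by rw [hy1]; norm_num)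
  have hΨ : ContinuousAt (fun z => star (Φ z) * Φ z) y := hΦ.star.mul hΦ
  have e1 : ∀ᶠ z in nhds y, ‖star y * y - star (Φ z) * Φ z‖ < η := by
    have := Metric.tendsto_nhds.1 hΨ η hη
    filter_upwards [this] with z hz
    rwa [hΦy, dist_comm, dist_eq_norm] at hz
  have e2 : ∀ᶠ z in nhds y, z ≠ 0 :=
    isOpen_ne.mem_nhds (by rintro rfl; simp at hy1)
  obtain ⟨z, hz, hz1, hz2⟩ := (hdense.inter_nhds_nonempty (e1.and e2))
  obtain ⟨n, hn⟩ := Set.mem_iUnion.1 hz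
  refine ⟨n, Φ z, (S n).smul_mem hn _, ?_, hz1⟩
  have : ‖Φ z‖ = 1 := by
    simp only [Φ, norm_smul, Complex.norm_real, norm_inv, norm_norm]
    exact inv_mul_cancel₀ (norm_ne_zero_iff.2 hz2)
  rw [CStarRing.norm_star_mul_self, this, one_mul]

/-- An inductive limit of actions with the tracial Rokhlin property on
infinite-dimensional simple separable unital C*-algebras has the tracial Rokhlin property. -/
theorem stmt2 {A : Type*} [CStarAlgebra A] [TopologicalSpace.SeparableSpace A]
    (hAdim : ¬ FiniteDimensional ℂ A)
    (hAsimple : ∀ I : TwoSidedIdeal A, IsClosed (I : Set A) →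
      (∀ x ∈ I, x = (0 : A)) ∨ (∀ x : A, x ∈ I))
    {G : Type*} [Group G] [Fintype G]
    (α : G → A ≃⋆ₐ[ℂ] A)
    (hα1 : ∀ a : A, α 1 a = a)
    (hαmul : ∀ (g h : G) (a : A), α (g * h) a = α g (α h a))
    (S : ℕ → StarSubalgebra ℂ A)
    (hclosed : ∀ n, IsClosed (S n : Set A))
    (hmono : Monotone S)
    (hSdim : ∀ n, ¬ FiniteDimensional ℂ ↥(S n))
    (hSsimple : ∀ n, ∀ I : TwoSidedIdeal ↥(S n), IsClosed (I : Set ↥(S n)) →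
      (∀ x ∈ I, x = (0 : ↥(S n))) ∨ (∀ x : ↥(S n), x ∈ I))
    (hSsep : ∀ n, TopologicalSpace.SeparableSpace ↥(S n))
    (hinv : ∀ (g : G) (n : ℕ), (α g) '' (S n : Set A) = (S n : Set A))
    (hdense : Dense (⋃ n, (S n : Set A)))
    (hRok : ∀ (n : ℕ) (F : Finset A), (F : Set A) ⊆ (S n : Set A) → ∀ ε : ℝ, 0 < ε →
      ∀ x : A, x ∈ S n → (∃ y ∈ S n, x = star y * y) → ‖x‖ = 1 →
      ∃ e : G → A, (∀ g, e g ∈ S n) ∧ (∀ g, IsProjection (e g)) ∧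
        (∀ g h, g ≠ h → e g * e h = 0) ∧
        (∀ g h, ‖α g (e h) - e (g * h)‖ < ε) ∧
        (∀ g, ∀ a ∈ F, ‖e g * a - a * e g‖ < ε) ∧
        (∃ v ∈ S n, v * star v = 1 - ∑ g, e g ∧
          star v * v ∈ closure {y : A | ∃ a ∈ S n, y = x * a * x}) ∧
        ‖(∑ g, e g) * x * (∑ g, e g)‖ > 1 - ε) :
    TracialRokhlin α := by
  intro F ε hε x hxpos hx1
  obtain ⟨y, rfl⟩ := hxpos
  set x := star y * y with hxdef
  have hxs : star x = x := by rw [hxdef, star_mul, star_star]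
  set δ : ℝ := min ε 1 / 4 with hδdef
  have hmin : 0 < min ε 1 := lt_min hε one_pos
  have hδ : 0 < δ := by positivity
  have hδε : δ ≤ ε / 4 := by rw [hδdef]; linarith [min_le_left ε 1]
  have hδ1 : δ < 1 := by rw [hδdef]; linarith [min_le_right ε 1]
  obtain ⟨n₁, z, hzS, hz1, hxz⟩ := aux_approx_pos S hdense y hx1 (δ / 4) (by positivity)
  obtain ⟨n₂, φ, hφ⟩ := aux_approx S hmono hdense F (ε / 4) (by positivity)
  set n := max n₁ n₂
  have hz : z ∈ S n := hmono (le_max_left _ _) hzS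
  obtain ⟨w, k, hwS, hw1, hzw, hk, hkw⟩ := aux_cut (S n) (hclosed n) z hz hz1 δ hδ hδ1
  classical
  obtain ⟨e, -, hep, heo, heα, hec, ⟨v, -, hv1, hv2⟩, hen⟩ :=
    hRok n (F.image φ) (by
      intro b hb
      simp only [Finset.coe_image, Set.mem_image, Finset.mem_coe] at hb
      obtain ⟨a, ha, rfl⟩ := hb
      exact hmono (le_max_right _ _) (hφ a ha).1) (ε / 4) (by positivity)
      (star w * w) (mul_mem (star_mem hwS) hwS) ⟨w, hwS, rfl⟩ hw1
  have hE : IsProjection (∑ g, e g) := by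
    constructor
    · rw [star_sum]; exact Finset.sum_congr rfl fun g _ => (hep g).1
    · rw [Finset.sum_mul_sum]
      refine Finset.sum_congr rfl fun g _ => ?_
      rw [Finset.sum_eq_single g (fun h _ hh => heo g h hh.symm) (by simp)]
      exact (hep g).2
  have hnorm : ∀ p : A, IsProjection p → ‖p‖ ≤ 1 := fun p hp =>
    IsStarProjection.norm_le p ⟨hp.2, hp.1⟩
  refine ⟨e, hep, heo, fun g h => (heα g h).trans (by linarith), ?_, ?_, ?_⟩
  · intro g a ha
    have h1 := hec g (φ a) (Finset.mem_image_of_mem _ ha)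
    have h2 := (hφ a ha).2
    have h3 := hnorm _ (hep g)
    have e1 : e g * a - a * e g
        = (e g * φ a - φ a * e g) + (e g * (a - φ a) - (a - φ a) * e g) := by noncomm_ring
    have h4 : ‖e g * (a - φ a)‖ ≤ 1 * (ε / 4) := (norm_mul_le _ _).trans (by gcongr)
    have h5 : ‖(a - φ a) * e g‖ ≤ (ε / 4) * 1 := (norm_mul_le _ _).trans (by gcongr)
    rw [e1]
    linarith [norm_add_le (e g * φ a - φ a * e g) (e g * (a - φ a) - (a - φ a) * e g),
      norm_sub_le (e g * (a - φ a)) ((a - φ a) * e g)]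
  · set p := 1 - ∑ g, e g with hp
    have hpp : p * p = p := by
      rw [hp, mul_sub, sub_mul, sub_mul, hE.2]; simp
    -- `star v * v` is a projection
    have hpv : p * v = v := by
      have h0 : star (p * v - v) = 0 := by
        rw [← CStarRing.star_mul_self_eq_zero_iff, star_star]
        have hps : star p = p := by rw [hp, star_sub, star_one, hE.1]
        have : (p * v - v) * star (p * v - v)
            = p * (v * star v) * p - p * (v * star v) - (v * star v) * p + v * star v := by
          rw [star_sub, star_mul, hps]; noncomm_ring
        rw [this, hv1, hpp, hpp]; abel
      exact sub_eq_zero.1 (star_eq_zero.1 h0)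
    have hq : IsProjection (star v * v) := by
      refine ⟨by rw [star_mul, star_star], ?_⟩
      calc star v * v * (star v * v) = star v * ((v * star v) * v) := by simp only [mul_assoc]
        _ = star v * v := by rw [hv1, hpv]
    set q := star v * v with hqdef
    have hkq : k * (star z * z) * q = q := by
      have hcl : IsClosed {b : A | k * (star z * z) * b = b} :=
        isClosed_eq (by fun_prop) continuous_id
      refine (closure_minimal ?_ hcl) hv2
      rintro _ ⟨a, -, rfl⟩
      change k * (star z * z) * ((star w * w) * a * (star w * w)) = _
      rw [mul_assoc (star w * w) a, ← mul_assoc (k * (star z * z)) (star w * w), hkw]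
    have hkx : ‖k * x * q - q‖ ≤ 1 / 4 := by
      have e1 : k * x * q - q = k * (x - star z * z) * q := by
        rw [mul_sub, sub_mul, hkq]
      rw [e1]
      calc ‖k * (x - star z * z) * q‖ ≤ ‖k‖ * ‖x - star z * z‖ * ‖q‖ :=
            (norm_mul_le _ _).trans (by gcongr; exact norm_mul_le _ _)
        _ ≤ (1 / δ) * (δ / 4) * 1 := by gcongr; exact hnorm _ hq
        _ = 1 / 4 := by field_simp
    obtain ⟨u, b, hu1, hu2⟩ := aux_rotate x k q hxs hq hkx
    have huq : u * q = u := by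
      have h0 : u * q - u = 0 := by
        rw [← CStarRing.star_mul_self_eq_zero_iff]
        have : star (u * q - u) * (u * q - u)
            = q * (star u * u) * q - q * (star u * u) - (star u * u) * q + star u * u := by
          rw [star_sub, star_mul, hq.1]; noncomm_ring
        rw [this, hu1, hq.2, hq.2]; abel
      exact sub_eq_zero.1 h0
    refine ⟨v * star u, ?_, subset_closure ⟨b, ?_⟩⟩
    · calc v * star u * star (v * star u) = v * (star u * u) * star v := by
            rw [star_mul, star_star]; simp only [mul_assoc]
        _ = (v * star v) * (v * star v) := by rw [hu1, hqdef]; simp only [mul_assoc]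
        _ = p := by rw [hv1, hpp]
    · calc star (v * star u) * (v * star u) = u * q * star u := by
            rw [star_mul, star_star, hqdef]; simp only [mul_assoc]
        _ = x * b * x := by rw [huq, hu2]
  · set E := ∑ g, e g
    have h1 : E * (star w * w) * E
        = E * x * E + E * (star w * w - x) * E := by noncomm_ring
    have h2 : ‖E * (star w * w - x) * E‖ ≤ 1 * ‖star w * w - x‖ * 1 := by
      refine (norm_mul_le _ _).trans ?_
      gcongr
      · exact (norm_mul_le _ _).trans (by gcongr; exact hnorm _ hE)
      · exact hnorm _ hE
    have h3 : ‖star w * w - x‖ ≤ δ + δ / 4 := by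
      have : star w * w - x = -(star z * z - star w * w) - (x - star z * z) := by abel
      rw [this]
      refine (norm_sub_le _ _).trans ?_
      rw [norm_neg]; linarith
    have h4 := norm_add_le (E * x * E) (E * (star w * w - x) * E)
    rw [← h1] at h4
    linarith
end

section
/- Let A be a unital C*-algebra over ℂ with Property (SP), let x ∈ A be a positive element with ‖x‖ = 1, and let ε > 0. Then there exists a nonzero projection p in Her(x) (the norm-closure of x A x) such that for every positive element q ∈ A with q ≤ p and ‖q‖ = 1 one has ‖q x^{1/2} − q‖ ≤ ε and ‖x^{1/2} q − q‖ ≤ ε, where x^{1/2} is the positive square root of x given by the continuous functional calculus. -/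
/-- If `z * a = k * a` then `z * y = k * y` for every `y` in `Her a`. -/
theorem her_mul_eq {A : Type*} [CStarAlgebra A] (a z k : A) (h : z * a = k * a) (y : A)
    (hy : y ∈ Her a) : z * y = k * y := by
  have hc : IsClosed {y : A | z * y = k * y} :=
    isClosed_eq (by fun_prop) (by fun_prop)
  refine closure_minimal ?_ hc hy
  rintro _ ⟨b, rfl⟩
  simp only [Set.mem_setOf_eq, ← mul_assoc, h]

theorem her_subset {A : Type*} [CStarAlgebra A] (x m : A) (h : x * m = m * x) :
    Her (x * m) ⊆ Her x := by
  refine closure_mono ?_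
  rintro _ ⟨b, rfl⟩
  refine ⟨m * b * m, ?_⟩
  calc x * m * b * (x * m) = x * m * b * (m * x) := congrArg (x * m * b * ·) h
    _ = _ := by simp only [mul_assoc]

theorem le_proj_mul {A : Type*} [CStarAlgebra A] (p q : A) (hp : IsProjection p)
    (hq : IsPositiveElem q) (hpq : IsPositiveElem (p - q)) : p * q = q ∧ q * p = q := by
  letI := CStarAlgebra.spectralOrder A
  haveI := CStarAlgebra.spectralOrderedRing A
  obtain ⟨hps, hpp⟩ := hp
  obtain ⟨y, rfl⟩ := hq
  obtain ⟨w, hw⟩ := hpq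
  have h0 : (1 - p) * p * (1 - p) = 0 := by
    rw [sub_mul, one_mul, hpp, sub_self, zero_mul]
  have hs : star (1 - p) = 1 - p := by simp [hps]
  have h1 : star (w * (1 - p)) * (w * (1 - p)) + star (y * (1 - p)) * (y * (1 - p)) = 0 := by
    rw [← h0]
    have : p = star w * w + star y * y := by rw [← hw]; abel
    conv_rhs => rw [mul_assoc, this, ← this]
    simp only [star_mul, hs]
    calc _ = (1 - p) * (star w * w + star y * y) * (1 - p) := by noncomm_ring
      _ = _ := by rw [← this, mul_assoc]
  have h2 : star (y * (1 - p)) * (y * (1 - p)) = 0 :=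
    ((add_eq_zero_iff_of_nonneg (star_mul_self_nonneg _) (star_mul_self_nonneg _)).1 h1).2
  have h3 : y * (1 - p) = 0 := CStarRing.star_mul_self_eq_zero_iff _ |>.1 h2
  have h4 : y * p = y := by
    rw [mul_sub, mul_one, sub_eq_zero] at h3; exact h3.symm
  have h5 : star y * y * p = star y * y := by rw [mul_assoc, h4]
  refine ⟨?_, h5⟩
  have := congrArg star h5
  simpa [hps, mul_assoc] using this

/-- In a unital C*-algebra with Property (SP), below any positive element of
norm one there is a nonzero projection in its hereditary subalgebra which is almost a unit
for it (w.r.t. the square root). Here `s` ranges over the positive square roots of `x`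
(there is exactly one such element). -/
theorem stmt3 {A : Type*} [CStarAlgebra A]
    (hSP : HasSP A)
    (x : A) (hx : IsPositiveElem x) (hx1 : ‖x‖ = 1) (ε : ℝ) (hε : 0 < ε) :
    ∃ p ∈ Her x, IsProjection p ∧ p ≠ 0 ∧
      ∀ s : A, IsPositiveElem s → s * s = x →
        ∀ q : A, IsPositiveElem q → IsPositiveElem (p - q) → ‖q‖ = 1 →
          ‖q * s - q‖ ≤ ε ∧ ‖s * q - q‖ ≤ ε := by
  letI := CStarAlgebra.spectralOrder A
  haveI := CStarAlgebra.spectralOrderedRing A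
  have hx0 : 0 ≤ x := by obtain ⟨y, rfl⟩ := hx; exact star_mul_self_nonneg y
  have hsa : IsSelfAdjoint x := hx0.isSelfAdjoint
  haveI : Nontrivial A := ⟨⟨x, 0, by rintro rfl; simp at hx1⟩⟩
  have hspec : ∀ t ∈ spectrum ℝ x, 0 ≤ t ∧ t ≤ 1 := fun t ht =>
    ⟨spectrum_nonneg_of_nonneg hx0 ht, by
      have := spectrum.norm_le_norm_of_mem ht
      rw [hx1] at this
      exact (le_abs_self t).trans this⟩
  have h1mem : (1 : ℝ) ∈ spectrum ℝ x := by
    have := CStarAlgebra.norm_mem_spectrum_of_nonneg (a := x) hx0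
    rwa [hx1] at this
  let M : ℝ → ℝ := fun t => max 0 (t - (1 - ε))
  let K : ℝ → ℝ := fun t => min (1 - √t) ε
  have hM : Continuous M := by fun_prop
  have hK : Continuous K := by fun_prop
  have hM0 : ∀ t, 0 ≤ M t := fun t => le_max_left _ _
  set m := cfc M x with hm
  set k := cfc K x with hk
  have hxm : x * m = cfc (fun t => t * M t) x := by
    rw [cfc_mul (fun t => t) M x, cfc_id' ℝ x]
  have hcomm : x * m = m * x := by
    rw [hxm, hm]
    conv_rhs => rw [← cfc_id' ℝ x]
    rw [cfc_id' ℝ x, ← hm]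
    conv_rhs => rw [hm]; arg 2; rw [← cfc_id' ℝ x]
    rw [← cfc_mul M (fun t => t) x]
    simp only [mul_comm]
  have ha0 : 0 ≤ x * m := by
    rw [hxm]
    exact cfc_nonneg fun t ht => mul_nonneg (hspec t ht).1 (hM0 t)
  have hane : x * m ≠ 0 := by
    intro h
    have : (fun t => t * M t) 1 ∈ spectrum ℝ (x * m) := by
      rw [hxm, cfc_map_spectrum (fun t => t * M t) x]
      exact ⟨1, h1mem, rfl⟩
    rw [h, spectrum.zero_eq] at this
    simp [M] at this
    linarith
  have hapos : IsPositiveElem (x * m) := by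
    obtain ⟨y, hy⟩ := CStarAlgebra.nonneg_iff_eq_star_mul_self.1 ha0
    exact ⟨y, hy⟩
  obtain ⟨p, hpa, hp, hpne⟩ := hSP _ hapos hane
  refine ⟨p, her_subset x m hcomm hpa, hp, hpne, ?_⟩
  intro s hs hss q hq hpq hq1
  have hs0 : 0 ≤ s := by obtain ⟨y, rfl⟩ := hs; exact star_mul_self_nonneg y
  have hscfc : s = cfc Real.sqrt x := by
    rw [← CFC.sqrt_unique hss hs0, CFC.sqrt_eq_real_sqrt x hx0, cfcₙ_eq_cfc]
  have hkm : (1 - s) * (x * m) = k * (x * m) := by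
    have h1 : 1 - s = cfc (fun t => 1 - √t) x := by
      rw [cfc_sub (fun _ => 1) Real.sqrt x, cfc_const_one ℝ x, hscfc]
    rw [h1, hxm, hk, ← cfc_mul _ _ x, ← cfc_mul _ _ x]
    refine cfc_congr fun t ht => ?_
    obtain ⟨t0, t1⟩ := hspec t ht
    by_cases htc : t ≤ 1 - ε
    · have : M t = 0 := max_eq_left (by linarith)
      simp [this]
    · have : K t = 1 - √t := by
        refine min_eq_left ?_
        have : t ≤ √t := by
          apply Real.le_sqrt_of_sq_le
          nlinarith
        linarith
      simp [this]
  have hkn : ‖k‖ ≤ ε := by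
    refine norm_cfc_le hε.le fun t ht => ?_
    obtain ⟨t0, t1⟩ := hspec t ht
    have : 0 ≤ K t := le_min (by simpa using t1) hε.le
    rw [Real.norm_of_nonneg this]
    exact min_le_right _ _
  obtain ⟨hpq', -⟩ := le_proj_mul p q hp hq hpq
  have hkp := her_mul_eq _ _ _ hkm p hpa
  have hkq : (1 - s) * q = k * q := by
    rw [← hpq', ← mul_assoc, hkp, mul_assoc]
  have hqn : ‖s * q - q‖ ≤ ε := by
    have : s * q - q = -(k * q) := by rw [← hkq]; noncomm_ring
    rw [this, norm_neg]
    calc _ ≤ ‖k‖ * ‖q‖ := norm_mul_le _ _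
      _ ≤ ε := by rw [hq1, mul_one]; exact hkn
  have hqsa : star q = q := by obtain ⟨y, rfl⟩ := hq; simp
  have hssa : star s = s := hs0.isSelfAdjoint
  refine ⟨?_, hqn⟩
  have : q * s - q = star (s * q - q) := by simp [hqsa, hssa]
  rw [this, norm_star]
  exact hqn
end

section
/- Let A be a C*-algebra over ℂ and suppose there is an increasing sequence (A_n) of closed *-subalgebras of A such that ⋃_n A_n is dense in A and each A_n has Property (SP) (as a C*-algebra in its own right). Then A has Property (SP). -/
/-- Neumann-type argument in a corner: if `‖p * h * p - p‖ < 1` then `p * h * p` is invertible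
in the corner. -/
theorem corner_inv {A : Type*} [NonUnitalCStarAlgebra A] (p h : A) (hp : IsProjection p)
    (hh : star h = h) (hn : ‖p - p * h * p‖ < 1) :
    ∃ w : A, star w = w ∧ p * w = w ∧ w * p = w ∧ p * h * p * w = p := by
  obtain ⟨hps, hpp⟩ := hp
  set d := p - p * h * p with hd
  have hpd : p * d = d := by
    simp only [hd, mul_sub, ← mul_assoc, hpp]
  have hc : ContractingWith ⟨‖d‖, norm_nonneg _⟩ (fun w : A => p + d * w) := by
    refine ⟨hn, LipschitzWith.of_dist_le_mul fun x y => ?_⟩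
    rw [dist_add_left, dist_eq_norm, dist_eq_norm, ← mul_sub]
    exact norm_mul_le _ _
  obtain ⟨w, hw⟩ : ∃ w : A, p + d * w = w := ⟨_, hc.fixedPoint_isFixedPt⟩
  have hpw : p * w = w := by
    calc p * w = p * (p + d * w) := by rw [hw]
      _ = p + d * w := by rw [mul_add, hpp, ← mul_assoc, hpd]
      _ = w := hw
  have hx : p * h * p * w = p := by
    have : p * h * p = p - d := by rw [hd]; abel
    rw [this, sub_mul, hpw]
    exact sub_eq_of_eq_add hw.symm
  have hxs : star w * (p * h * p) = p := by
    have := congrArg star hx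
    simpa [star_mul, hps, hh, mul_assoc] using this
  have hwp : star w * p = star w := by
    have := congrArg star hpw
    simpa [star_mul, hps] using this
  have hsw : star w = w := by
    calc star w = star w * p := hwp.symm
      _ = star w * (p * h * p * w) := by rw [hx]
      _ = star w * (p * h * p) * w := by simp only [mul_assoc]
      _ = w := by rw [hxs, hpw]
  exact ⟨w, hsw, hpw, by rw [hsw] at hwp; exact hwp, hx⟩

/-- A projection in `a A a` from a projection almost dominated by `a * a`. -/
theorem exists_proj {A : Type*} [NonUnitalCStarAlgebra A] (p a : A) (hp : IsProjection p)
    (hp0 : p ≠ 0) (ha : star a = a) (hn : ‖p - p * (a * a) * p‖ < 1) :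
    ∃ w : A, IsProjection (a * w * a) ∧ a * w * a ≠ 0 := by
  obtain ⟨w, hsw, hpw, hwp, hx⟩ := corner_inv p (a * a) hp (by rw [star_mul, ha]) hn
  have hwaw : w * (a * a) * w = w := by
    calc w * (a * a) * w = (w * p) * (a * a) * (p * w) := by rw [hpw, hwp]
      _ = w * (p * (a * a) * p * w) := by simp only [mul_assoc]
      _ = w := by rw [hx, hwp]
  refine ⟨w, ⟨by simp [star_mul, ha, hsw, mul_assoc], ?_⟩, fun h0 => hp0 ?_⟩
  · calc a * w * a * (a * w * a) = a * (w * (a * a) * w) * a := by simp only [mul_assoc]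
      _ = a * w * a := by rw [hwaw]
  · have hw0 : w = 0 := by
      calc w = w * (a * a) * (w * (a * a) * w) := by rw [hwaw, hwaw]
        _ = w * a * (a * w * a) * a * w := by simp only [mul_assoc]
        _ = 0 := by rw [h0]; simp
    rw [← hx, hw0, mul_zero]

/-- Cut-down functions of a self-adjoint element of norm about one. -/
theorem exists_cut {A : Type*} [NonUnitalCStarAlgebra A] (S : NonUnitalStarSubalgebra ℂ A)
    (hS : IsClosed (S : Set A)) (z : A) (hzS : z ∈ S) (hz : IsSelfAdjoint z)
    (h1 : 19 / 20 ≤ ‖z‖) (h2 : ‖z‖ ≤ 21 / 20) :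
    ∃ y ∈ S, star y = y ∧ y ≠ 0 ∧ ∃ g : A, g * y = y ∧ ‖z * z * g - g‖ ≤ 1 / 2 := by
  let f : ℝ → ℝ := fun t => max (t * t - 3 / 4) 0
  let k : ℝ → ℝ := fun t => max 0 (min 1 (4 * (t * t) - 2))
  have hf : Continuous f := by fun_prop
  have hk : Continuous k := by fun_prop
  have hf0 : f 0 = 0 := by simp only [f]; norm_num
  have hk0 : k 0 = 0 := by simp only [k]; norm_num
  refine ⟨cfcₙ f z, cfcₙ_mem (𝕜' := ℂ) (hs := hS) f hzS, (cfcₙ_predicate f z).star_eq, ?_, cfcₙ k z, ?_, ?_⟩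
  · intro h0
    obtain ⟨t, ht, htz⟩ :=
      (NonUnitalIsometricContinuousFunctionalCalculus.isGreatest_norm_quasispectrum (𝕜 := ℝ) z hz).1
    have := norm_apply_le_norm_cfcₙ f z ht hf.continuousOn hf0 hz
    rw [h0, norm_zero] at this
    have h3 : f t ≤ 0 := (le_abs_self _).trans this
    have h4 : t * t - 3 / 4 ≤ 0 := (le_max_left _ _).trans h3
    simp only [Real.norm_eq_abs] at htz
    have : |t| * |t| = t * t := abs_mul_abs_self t
    nlinarith
  · rw [← cfcₙ_mul k f z hk.continuousOn hk0 hf.continuousOn hf0]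
    refine cfcₙ_congr fun t _ => ?_
    simp only [f, k]
    rcases le_total (t * t - 3 / 4) 0 with h | h
    · rw [max_eq_right h, mul_zero]
    · rw [min_eq_left (by linarith), max_eq_right zero_le_one, one_mul]
  · have e : z * z * cfcₙ k z - cfcₙ k z = cfcₙ (fun t : ℝ => t * t * k t - k t) z := by
      rw [cfcₙ_sub (fun t : ℝ => t * t * k t) k z (by fun_prop) (by simp) (by fun_prop) hk0,
        cfcₙ_mul (fun t : ℝ => t * t) k z (by fun_prop) (by simp) (by fun_prop) hk0,
        cfcₙ_mul (fun t : ℝ => t) (fun t : ℝ => t) z, cfcₙ_id' ℝ z]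
    rw [e]
    refine norm_cfcₙ_le fun t ht => ?_
    have htz := NonUnitalIsometricContinuousFunctionalCalculus.norm_quasispectrum_le (𝕜 := ℝ) z ht hz
    rw [Real.norm_eq_abs] at htz
    have h5 : |t| * |t| = t * t := abs_mul_abs_self t
    have h6 : t * t ≤ 3 / 2 := by nlinarith [abs_nonneg t]
    have hk1 : 0 ≤ k t := le_max_left _ _
    have hk2 : k t ≤ 1 := max_le zero_le_one (min_le_left _ _)
    rw [Real.norm_eq_abs, abs_le]
    rcases le_total (t * t) (1 / 2) with h | h
    · have : k t = 0 := max_eq_left ((min_le_right _ _).trans (by linarith))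
      rw [this]; norm_num
    · constructor <;> nlinarith

/-- If a C*-algebra is the closure of an increasing union of closed
*-subalgebras each having Property (SP), then it has Property (SP). -/
theorem stmt4 {A : Type*} [NonUnitalCStarAlgebra A]
    (S : ℕ → NonUnitalStarSubalgebra ℂ A)
    (hclosed : ∀ n, IsClosed (S n : Set A))
    (hmono : Monotone S)
    (hdense : Dense (⋃ n, (S n : Set A)))
    (hSP : ∀ n, ∀ a ∈ S n, (∃ y ∈ S n, a = star y * y) → a ≠ 0 →
      ∃ p ∈ S n, IsProjection p ∧ p ≠ 0 ∧
        p ∈ closure {y : A | ∃ b ∈ S n, y = a * b * a}) :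
    HasSP A := by
  rintro a₀ ⟨y₀, hy₀⟩ ha₀
  have hs₀ : star a₀ = a₀ := by rw [hy₀]; simp
  set r : ℂ := ((‖a₀‖⁻¹ : ℝ) : ℂ) with hr
  set a : A := r • a₀ with ha
  have has : star a = a := by
    rw [ha, star_smul, hs₀, hr]; congr 1; exact Complex.conj_ofReal _
  have han : ‖a‖ = 1 := by
    rw [ha, norm_smul, hr, Complex.norm_real, norm_inv, norm_norm]
    exact inv_mul_cancel₀ (norm_ne_zero_iff.2 ha₀)
  suffices h : ∃ w : A, IsProjection (a * w * a) ∧ a * w * a ≠ 0 by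
    obtain ⟨w, hw1, hw2⟩ := h
    refine ⟨a * w * a, subset_closure ⟨(r * r) • w, ?_⟩, hw1, hw2⟩
    simp [ha, smul_mul_assoc, mul_smul_comm, smul_smul]
  obtain ⟨z₀, hz₀, hz₀a⟩ := Metric.dense_iff.1 hdense a (1 / 20) (by norm_num)
  obtain ⟨n, hn⟩ := Set.mem_iUnion.1 hz₀a
  rw [Metric.mem_ball, dist_eq_norm] at hz₀
  set z : A := (2⁻¹ : ℂ) • (z₀ + star z₀) with hz
  have hzS : z ∈ S n := SMulMemClass.smul_mem _ (add_mem hn (star_mem hn))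
  have hzs : star z = z := by
    rw [hz, star_smul, star_add, star_star, add_comm]; simp
  have hza : ‖z - a‖ < 1 / 20 := by
    have e : z - a = (2⁻¹ : ℂ) • ((z₀ - a) + star (z₀ - a)) := by
      have : a = (2⁻¹ : ℂ) • (a + a) := by
        rw [← two_smul ℂ a, smul_smul]; norm_num
      rw [star_sub, has]
      nth_rewrite 1 [this]
      rw [hz, ← smul_sub]; congr 1; abel
    rw [e, norm_smul]
    have := norm_add_le (z₀ - a) (star (z₀ - a))
    rw [norm_star] at this
    have h2 : ‖(2⁻¹ : ℂ)‖ = 1 / 2 := by norm_num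
    rw [h2]; linarith
  have hz1 : 19 / 20 ≤ ‖z‖ := by
    have := norm_sub_norm_le a z
    rw [norm_sub_rev] at this; linarith
  have hz2 : ‖z‖ ≤ 21 / 20 := by
    have := norm_sub_norm_le z a
    linarith
  obtain ⟨y, hyS, hys, hy0, g, hgy, hg⟩ := exists_cut (S n) (hclosed n) z hzS hzs hz1 hz2
  have hyy : star y * y ≠ 0 := by simpa using hy0
  obtain ⟨p, hpS, hp, hp0, hpc⟩ :=
    hSP n (star y * y) (mul_mem (star_mem hyS) hyS) ⟨y, hyS, rfl⟩ hyy
  have hgp : g * p = p := by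
    have hcl : IsClosed {u : A | g * u = u} := isClosed_eq (by fun_prop) continuous_id
    refine hcl.closure_subset_iff.2 ?_ hpc
    rintro _ ⟨b, -, rfl⟩
    simp only [Set.mem_ofPred_eq, hys, ← mul_assoc, hgy]
  have hpn : ‖p‖ ≤ 1 := by
    have h := CStarRing.norm_star_mul_self (x := p)
    rw [hp.1, hp.2] at h
    have : 0 < ‖p‖ := norm_pos_iff.2 hp0
    nlinarith
  have hzp : ‖z * z * p - p‖ ≤ 1 / 2 := by
    have e : z * z * p - p = (z * z * g - g) * p := by
      rw [sub_mul, mul_assoc _ g p, hgp]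
    rw [e]
    exact (norm_mul_le _ _).trans (by nlinarith [norm_nonneg (z * z * g - g), norm_nonneg p])
  have hzz : ‖z * z - a * a‖ ≤ 1 / 4 := by
    have e : z * z - a * a = z * (z - a) + (z - a) * a := by
      rw [mul_sub, sub_mul]; abel
    rw [e]
    refine (norm_add_le _ _).trans ?_
    have h1 := norm_mul_le z (z - a)
    have h2 := norm_mul_le (z - a) a
    rw [han] at h2
    nlinarith [norm_nonneg (z - a), norm_nonneg z]
  refine exists_proj p a hp hp0 has ?_
  have e : p - p * (a * a) * p = p * ((z * z - a * a) * p - (z * z * p - p)) := by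
    simp only [mul_sub, sub_mul, hp.2, mul_assoc]; abel
  rw [e]
  have h1 := norm_mul_le p ((z * z - a * a) * p - (z * z * p - p))
  have h2 := norm_sub_le ((z * z - a * a) * p) (z * z * p - p)
  have h3 := norm_mul_le (z * z - a * a) p
  have h4 : ‖z * z - a * a‖ * ‖p‖ ≤ 1 / 4 := by
    nlinarith [norm_nonneg (z * z - a * a), norm_nonneg p]
  nlinarith [norm_nonneg p, norm_nonneg ((z * z - a * a) * p - (z * z * p - p))]
end

section
/- Let G be a finite group and let ρ be a representation of G on a nonzero finite-dimensional complex vector space V, with character χ(g) = trace(ρ(g)). If χ(g) = 0 for every g ≠ 1 in G, then |G| divides dim_ℂ V, and V (as a module over the group algebra ℂ[G] via ρ) is isomorphic to the direct sum of (dim_ℂ V)/|G| copies of the regular module ℂ[G]; in other words, ρ is equivalent to a direct sum of (dim_ℂ V)/|G| copies of the left regular representation of G. -/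
open Module in
theorem aux_trace_prod {G : Type*} [Group G]
    {M N P : Type*} [AddCommGroup M] [Module ℂ M] [Module (MonoidAlgebra ℂ G) M]
    [IsScalarTower ℂ (MonoidAlgebra ℂ G) M] [FiniteDimensional ℂ M]
    [AddCommGroup N] [Module ℂ N] [Module (MonoidAlgebra ℂ G) N]
    [IsScalarTower ℂ (MonoidAlgebra ℂ G) N] [FiniteDimensional ℂ N]
    [AddCommGroup P] [Module ℂ P] [Module (MonoidAlgebra ℂ G) P]
    [IsScalarTower ℂ (MonoidAlgebra ℂ G) P]
    (e : (M × N) ≃ₗ[MonoidAlgebra ℂ G] P) (a : MonoidAlgebra ℂ G) :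
    LinearMap.trace ℂ P (Algebra.lsmul ℂ ℂ P a) =
      LinearMap.trace ℂ M (Algebra.lsmul ℂ ℂ M a) +
      LinearMap.trace ℂ N (Algebra.lsmul ℂ ℂ N a) := by
  rw [← LinearMap.trace_prodMap', ← LinearMap.trace_conj' _ (e.restrictScalars ℂ)]
  congr 1
  ext x
  obtain ⟨y, rfl⟩ := e.surjective x
  simp only [LinearEquiv.conj_apply_apply, Algebra.lsmul_coe]
  rw [← e.map_smul]
  have : (LinearEquiv.restrictScalars ℂ e).symm (e y) = y := e.symm_apply_apply y
  rw [this]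
  rfl

open Module in
theorem aux_exists_hom {G : Type*} [Group G] [Fintype G]
    {S M N : Type*} [AddCommGroup M] [Module ℂ M] [Module (MonoidAlgebra ℂ G) M]
    [IsScalarTower ℂ (MonoidAlgebra ℂ G) M] [FiniteDimensional ℂ M]
    [AddCommGroup N] [Module ℂ N] [Module (MonoidAlgebra ℂ G) N]
    [IsScalarTower ℂ (MonoidAlgebra ℂ G) N] [FiniteDimensional ℂ N]
    [AddCommGroup S] [Module ℂ S] [Module (MonoidAlgebra ℂ G) S]
    [IsScalarTower ℂ (MonoidAlgebra ℂ G) S] [FiniteDimensional ℂ S]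
    (h : ∀ g : G, LinearMap.trace ℂ M (Algebra.lsmul ℂ ℂ M (MonoidAlgebra.single g (1 : ℂ))) =
      LinearMap.trace ℂ N (Algebra.lsmul ℂ ℂ N (MonoidAlgebra.single g (1 : ℂ))))
    (f : S →ₗ[MonoidAlgebra ℂ G] M) (hf : f ≠ 0) :
    ∃ f' : S →ₗ[MonoidAlgebra ℂ G] N, f' ≠ 0 := by
  have : Invertible (Nat.card G : ℂ) := invertibleOfNonzero (by simp)
  let rS := Representation.ofModule' (k := ℂ) (G := G) S
  let rM := Representation.ofModule' (k := ℂ) (G := G) M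
  let rN := Representation.ofModule' (k := ℂ) (G := G) N
  have h1 := Representation.card_inv_mul_sum_char_mul_char_eq_finrank rS rM
  have h2 := Representation.card_inv_mul_sum_char_mul_char_eq_finrank rS rN
  have h3 : rM.character = rN.character := funext h
  rw [h3, h2] at h1
  have h4 : finrank ℂ (rS.IntertwiningMap rN) = finrank ℂ (rS.IntertwiningMap rM) := by
    exact_mod_cast h1
  have : FiniteDimensional ℂ (rS.IntertwiningMap rM) :=
    Module.Finite.equiv (Representation.invariantsEquivIntertwiningMap rS rM)
  have h5 : 0 < finrank ℂ (rS.IntertwiningMap rM) := by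
    let F : rS.IntertwiningMap rM := ⟨f.restrictScalars ℂ, fun g => by
      ext x; exact f.map_smul (MonoidAlgebra.single g (1 : ℂ)) x⟩
    refine finrank_pos_iff_exists_ne_zero.2 ⟨F, fun h0 => hf ?_⟩
    ext x
    exact congrArg (fun (φ : rS.IntertwiningMap rM) => φ x) h0
  rw [← h4] at h5
  have := nontrivial_of_finrank_pos h5
  obtain ⟨F, hF⟩ := exists_ne (0 : rS.IntertwiningMap rN)
  refine ⟨MonoidAlgebra.equivariantOfLinearOfComm F.toLinearMap (fun g v => ?_), fun h0 => hF ?_⟩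
  · exact congrArg (fun (φ : S →ₗ[ℂ] N) => φ v) (F.isIntertwining' g)
  · ext x
    exact congrArg (fun (φ : S →ₗ[MonoidAlgebra ℂ G] N) => φ x) h0

open Module in
theorem aux_iso {G : Type*} [Group G] [Fintype G] (n : ℕ) :
    ∀ {M : Type*} {N : Type*} [AddCommGroup M] [Module ℂ M] [Module (MonoidAlgebra ℂ G) M]
    [IsScalarTower ℂ (MonoidAlgebra ℂ G) M] [FiniteDimensional ℂ M]
    [AddCommGroup N] [Module ℂ N] [Module (MonoidAlgebra ℂ G) N]
    [IsScalarTower ℂ (MonoidAlgebra ℂ G) N] [FiniteDimensional ℂ N]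
    (_ : finrank ℂ M = n)
    (_ : ∀ g : G, LinearMap.trace ℂ M (Algebra.lsmul ℂ ℂ M (MonoidAlgebra.single g (1 : ℂ))) =
      LinearMap.trace ℂ N (Algebra.lsmul ℂ ℂ N (MonoidAlgebra.single g (1 : ℂ)))),
    Nonempty (M ≃ₗ[MonoidAlgebra ℂ G] N) := by
  induction n using Nat.strong_induction_on with
  | _ n ih =>
  intro M N _ _ _ _ _ _ _ _ _ _ hn h
  have hMN : finrank ℂ M = finrank ℂ N := by
    have := h 1
    rw [← MonoidAlgebra.one_def, map_one (Algebra.lsmul ℂ ℂ _), map_one (Algebra.lsmul ℂ ℂ _), LinearMap.trace_one,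
      LinearMap.trace_one] at this
    exact_mod_cast this
  rcases subsingleton_or_nontrivial M with hM | hM
  · have : Subsingleton N := by
      rw [← finrank_zero_iff (R := ℂ), ← hMN, finrank_zero_iff]; exact hM
    exact ⟨⟨0, 0, fun _ => Subsingleton.elim _ _, fun _ => Subsingleton.elim _ _⟩⟩
  have fd : ∀ {P : Type _} [AddCommGroup P] [Module ℂ P] [Module (MonoidAlgebra ℂ G) P]
    [IsScalarTower ℂ (MonoidAlgebra ℂ G) P] [FiniteDimensional ℂ P]
    (p : Submodule (MonoidAlgebra ℂ G) P), FiniteDimensional ℂ p := fun p =>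
      Module.Finite.of_injective (p.subtype.restrictScalars ℂ) p.injective_subtype
  have fd' : ∀ {P : Type _} [AddCommGroup P] [Module ℂ P] [Module (MonoidAlgebra ℂ G) P]
    [IsScalarTower ℂ (MonoidAlgebra ℂ G) P] [FiniteDimensional ℂ P]
    (p : Submodule (MonoidAlgebra ℂ G) P), FiniteDimensional ℂ p := fun p =>
      Module.Finite.of_injective (p.subtype.restrictScalars ℂ) p.injective_subtype
  obtain ⟨S, hS⟩ := IsSemisimpleModule.exists_simple_submodule (MonoidAlgebra ℂ G) M
  have := fd S
  have := hS.nontrivial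
  obtain ⟨f, hf⟩ := aux_exists_hom h S.subtype (fun h0 => by
    obtain ⟨x, hx⟩ := exists_ne (0 : S)
    exact hx (Subtype.ext (congrArg (fun (φ : S →ₗ[MonoidAlgebra ℂ G] M) => φ x) h0)))
  have hinj := LinearMap.injective_of_ne_zero hf
  obtain ⟨M', hM'⟩ := exists_isCompl S
  obtain ⟨N', hN'⟩ := exists_isCompl (LinearMap.range f)
  have := fd M'
  have := fd' N'
  let eM := Submodule.prodEquivOfIsCompl _ _ hM'
  let eN := ((LinearEquiv.ofInjective f hinj).prodCongr (LinearEquiv.refl _ N')).trans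
    (Submodule.prodEquivOfIsCompl _ _ hN')
  have hlt : finrank ℂ M' < n := by
    have h1 := (eM.restrictScalars ℂ).finrank_eq
    rw [finrank_prod] at h1
    have h2 : 0 < finrank ℂ S := finrank_pos
    omega
  obtain ⟨e'⟩ := ih _ hlt (M := M') (N := N') rfl (fun g => by
    have := h g
    rw [aux_trace_prod eM, aux_trace_prod eN] at this
    exact add_left_cancel this)
  exact ⟨eM.symm.trans (((LinearEquiv.refl _ S).prodCongr e').trans eN)⟩

theorem aux_trace_regular {G : Type*} [Group G] [Fintype G] (n : ℕ) (g : G) (hg : g ≠ 1) :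
    LinearMap.trace ℂ (Fin n → MonoidAlgebra ℂ G)
      (Algebra.lsmul ℂ ℂ _ (MonoidAlgebra.single g (1 : ℂ))) = 0 := by
  classical
  rw [LinearMap.trace_eq_matrix_trace ℂ
    (Pi.basis (fun _ : Fin n => MonoidAlgebra.basis G ℂ)), Matrix.trace]
  refine Finset.sum_eq_zero fun i _ => ?_
  obtain ⟨i, x⟩ := i
  rw [Matrix.diag_apply, LinearMap.toMatrix_apply]
  simp [Pi.basis_apply, MonoidAlgebra.basis, MonoidAlgebra.single_mul_single, hg]


/-- a finite-dimensional complex representation of a finite group whose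
character vanishes off the identity is a multiple of the regular representation. -/
theorem stmt10 {G : Type*} [Group G] [Fintype G]
    {V : Type*} [AddCommGroup V] [Module ℂ V] [FiniteDimensional ℂ V] [Nontrivial V]
    (ρ : Representation ℂ G V)
    (hχ : ∀ g : G, g ≠ 1 → LinearMap.trace ℂ V (ρ g) = 0) :
    Fintype.card G ∣ Module.finrank ℂ V ∧
      Nonempty (ρ.asModule ≃ₗ[MonoidAlgebra ℂ G]
        (Fin (Module.finrank ℂ V / Fintype.card G) → MonoidAlgebra ℂ G)) := by

  classical
  have hV : LinearMap.trace ℂ V (ρ 1) = Module.finrank ℂ V := by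
    rw [map_one, LinearMap.trace_one]
  have hG : (Fintype.card G : ℂ) ≠ 0 := by simp
  have hdvd : Fintype.card G ∣ Module.finrank ℂ V := by
    have : Invertible (Nat.card G : ℂ) := invertibleOfNonzero (by simp)
    have h1 := ρ.card_inv_mul_sum_char_eq_finrank
    rw [Finset.sum_eq_single (f := ρ.character) 1 (fun g _ hg => hχ g hg) (by simp), Representation.character, hV,
      Nat.card_eq_fintype_card, inv_mul_eq_iff_eq_mul₀ hG] at h1
    exact ⟨_, by exact_mod_cast h1⟩
  refine ⟨hdvd, aux_iso _ rfl fun g => ?_⟩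
  by_cases hg : g = 1
  · subst hg
    rw [← MonoidAlgebra.one_def, map_one (Algebra.lsmul ℂ ℂ _), map_one (Algebra.lsmul ℂ ℂ _), LinearMap.trace_one,
      LinearMap.trace_one,
      Module.finrank_pi_fintype]
    have : Module.finrank ℂ (MonoidAlgebra ℂ G) = Fintype.card G :=
      Module.finrank_eq_card_basis (MonoidAlgebra.basis G ℂ)
    simp only [this, Finset.sum_const, Finset.card_univ, Fintype.card_fin, smul_eq_mul,
      Nat.div_mul_cancel hdvd]
    rfl
  · rw [aux_trace_regular _ g hg]
    refine Eq.trans ?_ (hχ g hg)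
    rw [← LinearMap.trace_conj' _ ρ.asModuleEquiv]
    congr 1
    ext x
    simp [LinearEquiv.conj_apply_apply]
    rfl
end

section
/- Let A and B be unital C*-algebras over ℂ, G a finite group, and α : G → Aut(A), β : G → Aut(B) actions by *-automorphisms. Let π : G → Aut(A × B) be the direct sum action π_g(a, b) = (α_g(a), β_g(b)) on the product C*-algebra A × B. Then π has the weak tracial Rokhlin property if and only if both α and β have the weak tracial Rokhlin property. -/
/-- The part of the weak tracial Rokhlin property without the norm condition. -/
def WTRCore {A : Type*} [Ring A] [StarRing A] [Algebra ℂ A] [Norm A]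
    [TopologicalSpace A] {G : Type*} [Group G] [Fintype G] (α : G → A ≃⋆ₐ[ℂ] A)
    (F : Finset A) (ε : ℝ) (x : A) (e : G → A) : Prop :=
  (∀ g, IsProjection (e g)) ∧
      (∀ g h, g ≠ h → e g * e h = 0) ∧
      (∀ g h, ‖α g (e h) - e (g * h)‖ < ε) ∧
      (∀ g, ∀ a ∈ F, ‖e g * a - a * e g‖ < ε) ∧
      ProjSubEquiv (1 - ∑ g, e g) x

theorem wtr_iff_core {A : Type*} [Ring A] [StarRing A] [Algebra ℂ A] [Norm A]
    [TopologicalSpace A] {G : Type*} [Group G] [Fintype G] (α : G → A ≃⋆ₐ[ℂ] A) :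
    WeakTracialRokhlin α ↔ ∀ (F : Finset A) (ε : ℝ), 0 < ε →
    ∀ b : A, IsPositiveElem b → ‖b‖ = 1 →
    ∀ x : A, IsPositiveElem x → IsFull x →
    ∃ e : G → A, WTRCore α F ε x e ∧ ‖(∑ g, e g) * b * (∑ g, e g)‖ > 1 - ε := by
  simp only [WeakTracialRokhlin, WTRCore, and_assoc]

theorem wtr_weak {A : Type*} [CStarAlgebra A] {G : Type*} [Group G] [Fintype G]
    (α : G → A ≃⋆ₐ[ℂ] A) (h : WeakTracialRokhlin α) (F : Finset A) (ε : ℝ) (hε : 0 < ε)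
    (x : A) (hx : IsPositiveElem x) (hf : IsFull x) : ∃ e : G → A, WTRCore α F ε x e := by
  rcases subsingleton_or_nontrivial A with hA | hA
  · refine ⟨0, fun g => ⟨Subsingleton.elim _ _, Subsingleton.elim _ _⟩,
      fun _ _ _ => Subsingleton.elim _ _, fun g h => ?_, fun g a _ => ?_, 0,
      Subsingleton.elim _ _, subset_closure ⟨0, Subsingleton.elim _ _⟩⟩
    · rw [Subsingleton.elim (_ - _) (0 : A), norm_zero]; exact hε
    · rw [Subsingleton.elim (_ - _) (0 : A), norm_zero]; exact hε
  · obtain ⟨e, he, -⟩ := (wtr_iff_core α).1 h F ε hε 1 ⟨1, by simp⟩ (by simp) x hx hf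
    exact ⟨e, he⟩

theorem her_prod {A B : Type*} [CStarAlgebra A] [CStarAlgebra B] (x y : A × B) :
    y ∈ Her x ↔ y.1 ∈ Her x.1 ∧ y.2 ∈ Her x.2 := by
  have : {y | ∃ a, y = x * a * x} =
      {y | ∃ a, y = x.1 * a * x.1} ×ˢ {y | ∃ a, y = x.2 * a * x.2} := by
    ext ⟨y1, y2⟩
    simp [Prod.ext_iff]
  rw [Her, this, closure_prod_eq]
  rfl

theorem projSubEquiv_prod {A B : Type*} [CStarAlgebra A] [CStarAlgebra B] (p x : A × B) :
    ProjSubEquiv p x ↔ ProjSubEquiv p.1 x.1 ∧ ProjSubEquiv p.2 x.2 := by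
  constructor
  · rintro ⟨v, rfl, h⟩
    rw [her_prod] at h
    exact ⟨⟨v.1, rfl, h.1⟩, ⟨v.2, rfl, h.2⟩⟩
  · rintro ⟨⟨v, h1, h2⟩, ⟨w, h3, h4⟩⟩
    exact ⟨(v, w), Prod.ext h1 h3, (her_prod _ _).2 ⟨h2, h4⟩⟩

theorem isPositiveElem_prod {A B : Type*} [CStarAlgebra A] [CStarAlgebra B] (x : A × B) :
    IsPositiveElem x ↔ IsPositiveElem x.1 ∧ IsPositiveElem x.2 := by
  constructor
  · rintro ⟨v, rfl⟩
    exact ⟨⟨v.1, rfl⟩, ⟨v.2, rfl⟩⟩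
  · rintro ⟨⟨v, h1⟩, ⟨w, h3⟩⟩
    exact ⟨(v, w), Prod.ext h1 h3⟩

theorem isFull_prod {A B : Type*} [CStarAlgebra A] [CStarAlgebra B] (x : A × B) :
    IsFull x ↔ IsFull x.1 ∧ IsFull x.2 := by
  constructor
  · intro h
    constructor
    · intro I hI hx a
      have := h (I.comap (RingHom.fst A B)) ?_ ?_ (a, 0)
      · simpa [TwoSidedIdeal.mem_comap] using this
      · exact hI.preimage continuous_fst
      · simpa [TwoSidedIdeal.mem_comap] using hx
    · intro I hI hx a
      have := h (I.comap (RingHom.snd A B)) ?_ ?_ (0, a)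
      · simpa [TwoSidedIdeal.mem_comap] using this
      · exact hI.preimage continuous_snd
      · simpa [TwoSidedIdeal.mem_comap] using hx
  · rintro ⟨h1, h2⟩ I hI hx a
    have k1 : (a.1, (0 : B)) ∈ I := by
      let J : TwoSidedIdeal A := TwoSidedIdeal.mk' {a | (a, (0 : B)) ∈ I}
        I.zero_mem
        (fun {x y} hx hy => by simpa using I.add_mem hx hy)
        (fun {x} hx => by simpa using I.neg_mem hx)
        (fun {x y} hy => by simpa using I.mul_mem_left (x, 0) _ hy)
        (fun {x y} hy => by simpa using I.mul_mem_right _ (y, 0) hy)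
      have hJ : ∀ a, a ∈ J ↔ (a, (0 : B)) ∈ I := fun a => by
        simp [J, TwoSidedIdeal.mem_mk']
      refine (hJ _).1 (h1 J ?_ ?_ _)
      · have : (J : Set A) = (fun a => (a, (0 : B))) ⁻¹' (I : Set (A × B)) := by
          ext a; exact hJ a
        rw [this]
        exact hI.preimage (by fun_prop)
      · rw [hJ]
        simpa [Prod.mul_def] using I.mul_mem_right _ (1, 0) hx
    have k2 : ((0 : A), a.2) ∈ I := by
      let J : TwoSidedIdeal B := TwoSidedIdeal.mk' {a | ((0 : A), a) ∈ I}
        I.zero_mem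
        (fun {x y} hx hy => by simpa using I.add_mem hx hy)
        (fun {x} hx => by simpa using I.neg_mem hx)
        (fun {x y} hy => by simpa using I.mul_mem_left (0, x) _ hy)
        (fun {x y} hy => by simpa using I.mul_mem_right _ (0, y) hy)
      have hJ : ∀ a, a ∈ J ↔ ((0 : A), a) ∈ I := fun a => by
        simp [J, TwoSidedIdeal.mem_mk']
      refine (hJ _).1 (h2 J ?_ ?_ _)
      · have : (J : Set B) = (fun a => ((0 : A), a)) ⁻¹' (I : Set (A × B)) := by
          ext a; exact hJ a
        rw [this]
        exact hI.preimage (by fun_prop)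
      · rw [hJ]
        simpa [Prod.mul_def] using I.mul_mem_right _ (0, 1) hx
    simpa using I.add_mem k1 k2

theorem isFull_one {A : Type*} [CStarAlgebra A] : IsFull (1 : A) := by
  intro I _ h a
  simpa using I.mul_mem_left a _ h

theorem core_prod {A B : Type*} [CStarAlgebra A] [CStarAlgebra B]
    {G : Type*} [Group G] [Fintype G]
    (α : G → A ≃⋆ₐ[ℂ] A) (β : G → B ≃⋆ₐ[ℂ] B)
    (π : G → (A × B) ≃⋆ₐ[ℂ] (A × B))
    (hπ : ∀ (g : G) (a : A) (b : B), π g (a, b) = (α g a, β g b))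
    (F : Finset (A × B)) (FA : Finset A) (FB : Finset B)
    (ε : ℝ) (x : A × B) (e : G → A × B)
    (hFA : ∀ a, a ∈ FA ↔ ∃ y ∈ F, y.1 = a) (hFB : ∀ a, a ∈ FB ↔ ∃ y ∈ F, y.2 = a) :
    WTRCore π F ε x e ↔
      WTRCore α FA ε x.1 (fun g => (e g).1) ∧ WTRCore β FB ε x.2 (fun g => (e g).2) := by
  have hπ' : ∀ g y, π g y = (α g y.1, β g y.2) := fun g y => hπ g y.1 y.2
  have hF : (∀ g, ∀ a ∈ F, ‖e g * a - a * e g‖ < ε) ↔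
      (∀ g, ∀ a ∈ FA, ‖(e g).1 * a - a * (e g).1‖ < ε) ∧
      (∀ g, ∀ a ∈ FB, ‖(e g).2 * a - a * (e g).2‖ < ε) := by
    simp only [hFA, hFB, Prod.norm_def, max_lt_iff, forall_exists_index, and_imp,
      forall_apply_eq_imp_iff₂, Prod.fst_sub, Prod.snd_sub, Prod.fst_mul, Prod.snd_mul,
      forall_and]
  unfold WTRCore
  rw [hF]
  simp only [projSubEquiv_prod, hπ', IsProjection, Prod.ext_iff, Prod.norm_def,
    max_lt_iff, Prod.fst_sub, Prod.snd_sub, Prod.fst_mul, Prod.snd_mul, Prod.fst_star,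
    Prod.snd_star, Prod.fst_sum, Prod.snd_sum, Prod.fst_one, Prod.snd_one, Prod.fst_zero,
    Prod.snd_zero, forall_and]
  tauto

/-- the direct sum action on `A × B` has the weak tracial Rokhlin property
iff both summand actions do. -/
theorem stmt12 {A B : Type*} [CStarAlgebra A] [CStarAlgebra B]
    {G : Type*} [Group G] [Fintype G]
    (α : G → A ≃⋆ₐ[ℂ] A) (β : G → B ≃⋆ₐ[ℂ] B)
    (hα1 : ∀ a : A, α 1 a = a)
    (hαmul : ∀ (g h : G) (a : A), α (g * h) a = α g (α h a))
    (hβ1 : ∀ b : B, β 1 b = b)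
    (hβmul : ∀ (g h : G) (b : B), β (g * h) b = β g (β h b))
    (π : G → (A × B) ≃⋆ₐ[ℂ] (A × B))
    (hπ : ∀ (g : G) (a : A) (b : B), π g (a, b) = (α g a, β g b)) :
    WeakTracialRokhlin π ↔ WeakTracialRokhlin α ∧ WeakTracialRokhlin β := by
  classical
  constructor
  · intro h
    rw [wtr_iff_core] at h
    constructor
    · rw [wtr_iff_core]
      intro F ε hε b hb hb1 x hx hf
      obtain ⟨e, he, hn⟩ := h (F.image fun a => (a, 0)) ε hε (b, 0)
        ((isPositiveElem_prod _).2 ⟨hb, 0, by simp⟩) (by simp [Prod.norm_def, hb1]) (x, 1)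
        ((isPositiveElem_prod _).2 ⟨hx, 1, by simp⟩) ((isFull_prod _).2 ⟨hf, isFull_one⟩)
      rw [core_prod α β π hπ _ F ((F.image fun a => (a, (0 : B))).image Prod.snd) ε _ e
        (by simp) (by simp)] at he
      refine ⟨_, he.1, ?_⟩
      simpa [Prod.norm_def, Prod.fst_sum, Prod.snd_sum] using hn
    · rw [wtr_iff_core]
      intro F ε hε b hb hb1 x hx hf
      obtain ⟨e, he, hn⟩ := h (F.image fun a => (0, a)) ε hε (0, b)
        ((isPositiveElem_prod _).2 ⟨⟨0, by simp⟩, hb⟩) (by simp [Prod.norm_def, hb1]) (1, x)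
        ((isPositiveElem_prod _).2 ⟨⟨1, by simp⟩, hx⟩) ((isFull_prod _).2 ⟨isFull_one, hf⟩)
      rw [core_prod α β π hπ _ ((F.image fun a => ((0 : A), a)).image Prod.fst) F ε _ e
        (by simp) (by simp)] at he
      refine ⟨_, he.2, ?_⟩
      simpa [Prod.norm_def, Prod.fst_sum, Prod.snd_sum] using hn
  · rintro ⟨hA, hB⟩
    rw [wtr_iff_core]
    intro F ε hε b hb hb1 x hx hf
    rw [isPositiveElem_prod] at hb hx
    rw [isFull_prod] at hf
    have key := fun e => core_prod α β π hπ F (F.image Prod.fst) (F.image Prod.snd) ε x e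
      (by simp) (by simp)
    have hcase : ‖b.1‖ = 1 ∨ ‖b.2‖ = 1 := by
      rw [Prod.norm_def] at hb1
      rcases max_choice ‖b.1‖ ‖b.2‖ with h | h
      · left; rw [← h, hb1]
      · right; rw [← h, hb1]
    rcases hcase with h | h
    · obtain ⟨e, he, hn⟩ := (wtr_iff_core α).1 hA (F.image Prod.fst) ε hε b.1 hb.1 h x.1 hx.1 hf.1
      obtain ⟨f, hf⟩ := wtr_weak β hB (F.image Prod.snd) ε hε x.2 hx.2 hf.2
      refine ⟨fun g => (e g, f g), (key _).2 ⟨he, hf⟩, lt_of_lt_of_le hn ?_⟩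
      refine le_trans (le_of_eq ?_) (norm_fst_le _)
      simp [Prod.fst_sum]
    · obtain ⟨e, he, hn⟩ := (wtr_iff_core β).1 hB (F.image Prod.snd) ε hε b.2 hb.2 h x.2 hx.2 hf.2
      obtain ⟨f, hf⟩ := wtr_weak α hA (F.image Prod.fst) ε hε x.1 hx.1 hf.1
      refine ⟨fun g => (f g, e g), (key _).2 ⟨hf, he⟩, lt_of_lt_of_le hn ?_⟩
      refine le_trans (le_of_eq ?_) (norm_snd_le _)
      simp [Prod.snd_sum]
end

section
/- Let A be an infinite-dimensional simple separable unital C*-algebra over ℂ (simple: every closed two-sided ideal of A is {0} or A), G a finite group, and α : G → Aut(A) an action by *-automorphisms. Then α has the tracial Rokhlin property if and only if α has the weak tracial Rokhlin property. -/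
open CFC in
/-- Transfer of subequivalence: from `z z*` to a factorization through `z`. -/
theorem subequiv_transfer {A : Type*} [CStarAlgebra A] [PartialOrder A] [StarOrderedRing A]
    {p z v : A} (hp : p * p = p) (hps : star p = p) (hv : v * star v = p)
    (hmem : star v * v ∈ Her (z * star z)) :
    ∃ k : A, (k * z) * star (k * z) = p := by
  have hpv : p * v = v := by
    have h0 : (v - p * v) * star (v - p * v) = 0 := by
      have : (v - p * v) * star (v - p * v)
          = v * star v - (v * star v) * star p - p * (v * star v) + p * (v * star v) * star p := by
        simp only [star_sub, star_mul]; noncomm_ring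
      rw [this, hv, hps, hp, hp]; simp
    exact (sub_eq_zero.1 ((CStarRing.mul_star_self_eq_zero_iff _).1 h0)).symm
  obtain ⟨q, hq⟩ : ∃ q, q = star v * v := ⟨_, rfl⟩
  have hqs : star q = q := by rw [hq]; simp
  have hvq : v * q = v := by rw [hq, ← mul_assoc, hv, hpv]
  have hqq : q * q = q := by
    calc q * q = star v * (v * q) := by rw [← mul_assoc, ← hq]
      _ = q := by rw [hvq, hq]
  have hqv : q * star v = star v := by
    have := congrArg star hvq
    rwa [star_mul, hqs] at this
  rw [← hq] at hmem
  have hqp : IsStarProjection q := ⟨hqq, hqs⟩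
  have hqn : ‖q‖ ≤ 1 := hqp.norm_le
  obtain ⟨y, ⟨a, rfl⟩, hy⟩ := Metric.mem_closure_iff.1 hmem (1/4) (by norm_num)
  rw [dist_eq_norm] at hy
  obtain ⟨T, hT⟩ : ∃ T, T = star z * a * (z * star z) := ⟨_, rfl⟩
  obtain ⟨d, hd⟩ : ∃ d, d = q * z * T := ⟨_, rfl⟩
  have hdq : ‖q - d‖ < 1/4 := by
    have : q - d = q * (q - z * star z * a * (z * star z)) := by
      rw [mul_sub, hqq, hd, hT]; noncomm_ring
    rw [this]
    refine (norm_mul_le _ _).trans_lt ?_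
    nlinarith [norm_nonneg (q - z * star z * a * (z * star z))]
  have hdd : ‖q - d * star d‖ < 1 := by
    have h1 : q - d * star d = q * star (q - d) + (q - d) * star q - (q - d) * star (q - d) := by
      simp only [star_sub, hqs]
      rw [mul_sub, sub_mul, sub_mul, mul_sub, mul_sub, hqq]; abel
    rw [h1]
    refine (norm_sub_le _ _).trans_lt ?_
    have h2 := norm_add_le (q * star (q - d)) ((q - d) * star q)
    have h3 := norm_mul_le q (star (q - d))
    have h4 := norm_mul_le (q - d) (star q)
    have h5 := norm_mul_le (q - d) (star (q - d))
    rw [norm_star] at h3 h4 h5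
    nlinarith [norm_nonneg (q - d), norm_nonneg q]
  have h1q : (0 : A) ≤ 1 - q := by simpa using hqp.one_sub.nonneg
  have hsp : IsStrictlyPositive (d * star d + (1 - q)) := by
    refine ⟨add_nonneg (mul_star_self_nonneg d) h1q, ?_⟩
    have := isUnit_one_sub_of_norm_lt_one hdd
    convert this using 1
    abel
  obtain ⟨r, hr⟩ : ∃ r, r = q * z * star z * q + (1 - q) := ⟨_, rfl⟩
  have hqzz : q * z * star z * q = (q * z) * star (q * z) := by
    rw [star_mul, hqs]; noncomm_ring
  have hr0 : 0 ≤ r := by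
    rw [hr, hqzz]
    exact add_nonneg (mul_star_self_nonneg _) h1q
  have hle : d * star d + (1 - q) ≤ (‖T‖ ^ 2 + 1) • r := by
    have h1 : d * star d ≤ ‖T‖ ^ 2 • (q * z * star z * q) := by
      have h := star_right_conjugate_le_conjugate
        (CStarAlgebra.mul_star_le_algebraMap_norm_sq (a := T)) (q * z)
      rw [Algebra.algebraMap_eq_smul_one] at h
      rw [hqzz]
      convert h using 1
      · rw [hd, star_mul]; noncomm_ring
      · simp
    have h2 : (0 : A) ≤ ‖T‖ ^ 2 • (1 - q) := smul_nonneg (by positivity) h1q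
    have h3 : (0 : A) ≤ q * z * star z * q := by rw [hqzz]; exact mul_star_self_nonneg _
    rw [add_smul, one_smul, hr, smul_add]
    calc _ ≤ ‖T‖ ^ 2 • (q * z * star z * q) + (1 - q) := by gcongr
      _ ≤ ‖T‖ ^ 2 • (q * z * star z * q) + (1 - q) + (‖T‖ ^ 2 • (1 - q) + q * z * star z * q) :=
        le_add_of_nonneg_right (add_nonneg h2 h3)
      _ = _ := by abel
  have hru : IsUnit r := by
    have h := CStarAlgebra.isUnit_of_le _ hle hsp
    have hc : (‖T‖ ^ 2 + 1 : ℝ) ≠ 0 := by positivity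
    exact (isUnit_smul_iff (Units.mk0 _ hc) r).1 h
  have hrsp : IsStrictlyPositive r := ⟨hr0, hru⟩
  have hqr : q * r = q * z * star z * q := by
    rw [hr, mul_add, mul_sub, hqq, mul_one, sub_self, add_zero]
    simp only [← mul_assoc, hqq]
  have hrq : r * q = q * z * star z * q := by
    rw [hr, add_mul, sub_mul, hqq, one_mul, sub_self, add_zero]
    simp only [mul_assoc, hqq]
  obtain ⟨h, hh⟩ : ∃ h, h = r ^ (-(1 / 2) : ℝ) := ⟨_, rfl⟩
  have hhr : h * r * h = 1 := by rw [hh]; exact CFC.conjugate_rpow_neg_one_half r hrsp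
  have hhs : star h = h := by rw [hh]; exact (IsSelfAdjoint.of_nonneg rpow_nonneg).star_eq
  have hhq : h * q = q * h := by
    have hc : Commute r q := by rw [commute_iff_eq, hrq, hqr]
    rw [hh, CFC.rpow_def]
    exact hc.cfc_nnreal _
  refine ⟨v * h, ?_⟩
  calc v * h * z * star (v * h * z) = v * h * z * star z * h * star v := by
        rw [star_mul, star_mul, hhs]; noncomm_ring
    _ = (v * q) * h * z * star z * h * (q * star v) := by rw [hvq, hqv]
    _ = v * (q * h) * (z * star z) * (h * q) * star v := by noncomm_ring
    _ = v * h * (q * z * star z * q) * h * star v := by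
        rw [hhq]; nth_rw 1 [← hhq]; noncomm_ring
    _ = v * (h * q) * r * h * star v := by rw [← hqr]; noncomm_ring
    _ = v * q * (h * r * h) * star v := by rw [hhq]; noncomm_ring
    _ = p := by rw [hhr, hvq, mul_one, hv]

/-- A full element cannot be annihilated through `A` by a nonzero element. -/
theorem exists_mul_ne_zero {A : Type*} [CStarAlgebra A] {c x : A} (hc : c ≠ 0)
    (hx : IsFull x) : ∃ a, c * a * x ≠ 0 := by
  by_contra! hcon
  let I : TwoSidedIdeal A := TwoSidedIdeal.mk' {w | ∀ a, c * a * w = 0}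
    (by simp) (fun {x y} h1 h2 a => by rw [mul_add, h1, h2, add_zero])
    (fun {x} h a => by rw [mul_neg, h, neg_zero])
    (fun {x y} h a => by rw [← mul_assoc, mul_assoc c, h])
    (fun {x y} h a => by rw [← mul_assoc, h, zero_mul])
  have hI : IsClosed (I : Set A) := by
    rw [TwoSidedIdeal.coe_mk', Set.ofPred_forall]
    exact isClosed_iInter fun a => isClosed_eq (by fun_prop) continuous_const
  have h1 : (1 : A) ∈ I := hx I hI ((TwoSidedIdeal.mem_mk' ..).2 hcon) 1
  have := (TwoSidedIdeal.mem_mk' ..).1 h1 1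
  simp at this
  exact hc this

/-- Cut-down functions of a positive norm-one element. -/
theorem exists_cutdown {A : Type*} [CStarAlgebra A] [PartialOrder A] [StarOrderedRing A]
    {b : A} (hb : 0 ≤ b) (hb1 : ‖b‖ = 1) {δ : ℝ} (hδ : 0 < δ) (hδ1 : δ < 1) :
    ∃ c f : A, c ≠ 0 ∧ star c = c ∧ star f = f ∧ f * c = c ∧ (1 - δ) • (f * f) ≤ b := by
  have : Nontrivial A := ⟨b, 0, fun h => by simp [h] at hb1⟩
  have hbs : IsSelfAdjoint b := .of_nonneg hb
  have hd : 0 < 1 - δ := by linarith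
  refine ⟨cfc (fun t : ℝ => max (t - (1 - δ)) 0) b, cfc (fun t : ℝ => min (t / (1 - δ)) 1) b,
    ?_, ?_, ?_, ?_, ?_⟩
  · intro h0
    have h1 : (1 : ℝ) ∈ spectrum ℝ b := hb1 ▸ CStarAlgebra.norm_mem_spectrum_of_nonneg hb
    have := norm_apply_le_norm_cfc (fun t : ℝ => max (t - (1 - δ)) 0) b h1
      (by fun_prop) hbs
    rw [h0, norm_zero] at this
    have h2 := norm_le_zero_iff.1 this
    have h3 := le_max_left (1 - (1 - δ)) (0 : ℝ)
    rw [h2] at h3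
    linarith
  · exact (cfc_predicate _ _ : IsSelfAdjoint _).star_eq
  · exact (cfc_predicate _ _ : IsSelfAdjoint _).star_eq
  · rw [← cfc_mul _ _ b (by fun_prop) (by fun_prop)]
    refine cfc_congr fun t _ => ?_
    rcases le_total t (1 - δ) with h | h
    · simp [max_eq_right (sub_nonpos.2 h)]
    · simp [min_eq_right ((one_le_div hd).2 h)]
  · rw [← cfc_mul _ _ b (by fun_prop) (by fun_prop), ← cfc_smul _ _ b (by fun_prop)]
    conv_rhs => rw [← cfc_id ℝ b]
    refine cfc_mono (fun t ht => ?_) (by fun_prop) (by fun_prop)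
    have ht0 : 0 ≤ t := spectrum_nonneg_of_nonneg hb ht
    have hm0 : 0 ≤ min (t / (1 - δ)) 1 := le_min (by positivity) zero_le_one
    have hm1 : min (t / (1 - δ)) 1 ≤ 1 := min_le_right _ _
    have hm2 : (1 - δ) * min (t / (1 - δ)) 1 ≤ t := by
      calc _ ≤ (1 - δ) * (t / (1 - δ)) := by gcongr; exact min_le_left _ _
        _ = t := by field_simp
    simp only [smul_eq_mul, id]
    nlinarith [mul_nonneg hd.le hm0]

/-- on an infinite-dimensional simple separable unital C*-algebra, the
tracial and weak tracial Rokhlin properties coincide. -/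
theorem stmt13 {A : Type*} [CStarAlgebra A] [TopologicalSpace.SeparableSpace A]
    (hdim : ¬ FiniteDimensional ℂ A)
    (hsimple : ∀ I : TwoSidedIdeal A, IsClosed (I : Set A) →
      (∀ x ∈ I, x = (0 : A)) ∨ (∀ x : A, x ∈ I))
    {G : Type*} [Group G] [Fintype G]
    (α : G → A ≃⋆ₐ[ℂ] A)
    (hα1 : ∀ a : A, α 1 a = a)
    (hαmul : ∀ (g h : G) (a : A), α (g * h) a = α g (α h a)) :
    TracialRokhlin α ↔ WeakTracialRokhlin α := by
  constructor
  · intro hT F ε hε b hb hb1 x hx hfull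
    letI : PartialOrder A := CStarAlgebra.spectralOrder A
    haveI : StarOrderedRing A := CStarAlgebra.spectralOrderedRing A
    obtain ⟨y₀, hy₀⟩ := hb
    have hb0 : 0 ≤ b := hy₀ ▸ star_mul_self_nonneg y₀
    obtain ⟨x₀, hx₀⟩ := hx
    have hxs : star x = x := by rw [hx₀]; simp
    set δ : ℝ := min ε 1 / 2 with hδ
    have hm : 0 < min ε 1 := lt_min hε one_pos
    have hδ0 : 0 < δ := by positivity
    have hδ1 : δ < 1 := by have := min_le_right ε 1; linarith
    have hδε : 2 * δ ≤ ε := by have := min_le_left ε 1; linarith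
    obtain ⟨c, f, hc, hcs, hfs, hfc, hfb⟩ := exists_cutdown hb0 hb1 hδ0 hδ1
    obtain ⟨a₀, ha₀⟩ := exists_mul_ne_zero hc hfull
    have hn : ‖c * a₀ * x‖ ≠ 0 := norm_ne_zero_iff.2 ha₀
    obtain ⟨a, ha⟩ : ∃ a, a = ‖c * a₀ * x‖⁻¹ • a₀ := ⟨_, rfl⟩
    obtain ⟨z, hz⟩ : ∃ z, z = c * a * x := ⟨_, rfl⟩
    have hz1 : ‖z‖ = 1 := by
      rw [hz, ha, mul_smul_comm, smul_mul_assoc, norm_smul, norm_inv, norm_norm]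
      exact inv_mul_cancel₀ hn
    have hzz : ‖z * star z‖ = 1 := by rw [CStarRing.norm_self_mul_star, hz1, one_mul]
    have hfz : f * z = z := by rw [hz, ← mul_assoc, ← mul_assoc, hfc]
    obtain ⟨e, he1, he2, he3, he4, ⟨v, hv1, hv2⟩, he6⟩ :=
      hT F δ hδ0 (z * star z) ⟨star z, by simp⟩ hzz
    obtain ⟨E, hE⟩ : ∃ E, E = ∑ g, e g := ⟨_, rfl⟩
    rw [← hE] at hv1 he6
    have hEs : star E = E := by
      rw [hE, star_sum]
      exact Finset.sum_congr rfl fun g _ => (he1 g).1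
    have hEE : E * E = E := by
      rw [hE, Finset.sum_mul_sum]
      refine Finset.sum_congr rfl fun g _ => ?_
      rw [Finset.sum_eq_single g (fun h _ hne => he2 g h hne.symm) (by simp)]
      exact (he1 g).2
    refine ⟨e, he1, he2, fun g h => (he3 g h).trans_le (by linarith),
      fun g a ha => (he4 g a ha).trans_le (by linarith), ?_, ?_⟩
    · rw [← hE]
      obtain ⟨k, hk⟩ := subequiv_transfer (p := 1 - E)
        (by rw [mul_sub, sub_mul, sub_mul, hEE]; simp) (by simp [hEs]) hv1 hv2
      refine ⟨k * z, hk, subset_closure ⟨star a * star c * star k * k * c * a, ?_⟩⟩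
      rw [hz]
      simp only [star_mul, hxs]
      noncomm_ring
    · rw [← hE]
      have h1 : z * star z ≤ 1 :=
        (CStarAlgebra.norm_le_one_iff_of_nonneg _ (mul_star_self_nonneg z)).1 hzz.le
      have h2 : z * star z ≤ f * f := by
        have h := star_right_conjugate_le_conjugate h1 f
        have h' : f * (z * star z) * star f = z * star z := by
          calc f * (z * star z) * star f = (f * z) * star (f * z) := by
                rw [star_mul]; noncomm_ring
            _ = z * star z := by rw [hfz]
        rwa [h', mul_one, hfs] at h
      have h3 : (1 - δ) • (z * star z) ≤ b :=
        (smul_le_smul_of_nonneg_left h2 (by linarith)).trans hfb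
      have h4 := star_right_conjugate_le_conjugate h3 E
      rw [hEs, mul_smul_comm, smul_mul_assoc] at h4
      have h5 : 0 ≤ E * (z * star z) * E := by
        have h := star_right_conjugate_nonneg (mul_star_self_nonneg z) E
        rwa [hEs] at h
      have h6 := CStarAlgebra.norm_le_norm_of_nonneg_of_le
        (smul_nonneg (by linarith : (0:ℝ) ≤ 1 - δ) h5) h4
      rw [norm_smul, Real.norm_of_nonneg (by linarith : (0:ℝ) ≤ 1 - δ)] at h6
      nlinarith
  · intro hW F ε hε x hx hx1
    refine hW F ε hε x hx hx1 x hx fun I hI hxI => ?_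
    rcases hsimple I hI with h | h
    · simp [h x hxI] at hx1
    · exact h
end

section
/- Let A be an infinite-dimensional unital C*-algebra over ℂ, G a finite group, and α : G → Aut(A) an action by *-automorphisms. Then α has the weak tracial Rokhlin property if and only if the following formally stronger condition holds: for every finite set F ⊆ A, every ε > 0, every positive b ∈ A with ‖b‖ = 1, and every full positive x ∈ A, there are mutually orthogonal projections e_g ∈ A (g ∈ G) such that ‖α_g(e_h) − e_{gh}‖ < ε for all g, h ∈ G; ‖e_g a − a e_g‖ < ε for all g ∈ G, a ∈ F; the projection e = Σ_{g∈G} e_g satisfies α_g(e) = e for all g ∈ G; (1 − e) ⪯ x; and ‖e b e‖ > 1 − ε. -/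
open Topology

theorem proj_norm_le {A : Type*} [CStarAlgebra A] {p : A} (hp : IsProjection p) : ‖p‖ ≤ 1 :=
  IsStarProjection.norm_le p ⟨hp.2, hp.1⟩

theorem exists_proj_near {A : Type*} [CStarAlgebra A] (f : A) (hf : star f = f) (κ : ℝ)
    (hκ : κ < 1 / 4) (h : ‖f * f - f‖ ≤ κ) :
    ∃ p : A, IsProjection p ∧ ‖p - f‖ ≤ 2 * κ ∧
      ∀ φ : A ≃⋆ₐ[ℂ] A, φ f = f → φ p = p := by
  have hsa : IsSelfAdjoint f := hf
  have hκ0 : 0 ≤ κ := (norm_nonneg _).trans h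
  have hspec : ∀ t ∈ spectrum ℝ f, |t * t - t| ≤ κ := by
    intro t ht
    have h1 : cfc (fun t : ℝ => t * t - t) f = f * f - f := by
      rw [cfc_sub (fun t : ℝ => t * t) (fun t : ℝ => t) f,
        cfc_mul (fun t : ℝ => t) (fun t : ℝ => t) f, cfc_id' ℝ f]
    have h2 := norm_apply_le_norm_cfc (fun t : ℝ => t * t - t) f ht
    rw [h1] at h2
    exact (h2.trans h)
  set χ : ℝ → ℝ := fun t => if t < 1 / 2 then 0 else 1 with hχ
  have hcont : ContinuousOn χ (spectrum ℝ f) := by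
    intro t ht
    have hb := hspec t ht
    apply ContinuousAt.continuousWithinAt
    rcases lt_trichotomy t (1 / 2) with hlt | heq | hgt
    · have : χ =ᶠ[𝓝 t] fun _ => 0 := by
        filter_upwards [Iio_mem_nhds hlt] with s hs
        simp only [Set.mem_Iio] at hs
        simp only [hχ, if_pos hs]
      exact continuousAt_const.congr this.symm
    · subst heq
      norm_num [abs_of_neg] at hb
      linarith
    · have : χ =ᶠ[𝓝 t] fun _ => 1 := by
        filter_upwards [Ioi_mem_nhds hgt] with s hs
        simp only [Set.mem_Ioi] at hs
        simp only [hχ, if_neg (not_lt.mpr hs.le)]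
      exact continuousAt_const.congr this.symm
  refine ⟨cfc χ f, ⟨?_, ?_⟩, ?_, ?_⟩
  · exact (cfc_predicate χ f : IsSelfAdjoint _)
  · rw [← cfc_mul χ χ f hcont hcont]
    congr 1
    funext t
    simp only [hχ]
    split_ifs <;> simp
  · have h1 : cfc χ f - f = cfc (fun t => χ t - t) f := by
      rw [cfc_sub χ (fun t : ℝ => t) f hcont, cfc_id' ℝ f]
    rw [h1]
    refine norm_cfc_le (by linarith) fun t ht => ?_
    have hb := hspec t ht
    have h3 : |t| * |t - 1| ≤ κ := by
      rw [← abs_mul, mul_sub, mul_one]; exact hb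
    simp only [hχ, Real.norm_eq_abs]
    split_ifs with hlt
    · have : 1 / 2 ≤ |t - 1| := by rw [abs_of_neg (by linarith)]; linarith
      rw [zero_sub, abs_neg]
      nlinarith [abs_nonneg t]
    · have : 1 / 2 ≤ |t| := by
        rw [abs_of_nonneg (by linarith)]; linarith
      rw [abs_sub_comm]
      nlinarith [abs_nonneg (t - 1)]
  · intro φ hφ
    have hc : Continuous φ := (NonUnitalStarAlgHom.isometry φ φ.injective).continuous
    have := StarAlgHomClass.map_cfc (S := ℂ) φ χ f hcont hc
    rw [hφ] at this
    exact this

theorem exists_unitary_near {A : Type*} [CStarAlgebra A] (e p : A) (he : IsProjection e)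
    (hp : IsProjection p) (r : ℝ) (hr : r ≤ 1 / 100) (h : ‖p - e‖ ≤ r) :
    ∃ u : A, star u * u = 1 ∧ u * star u = 1 ∧ ‖u - 1‖ ≤ 40 * r ∧ u * e * star u = p := by
  have hr0 : 0 ≤ r := (norm_nonneg _).trans h
  have hone : ‖(1 : A)‖ ≤ 1 := proj_norm_le ⟨star_one A, one_mul 1⟩
  obtain ⟨he1, he2⟩ := he
  have hpn := proj_norm_le hp
  obtain ⟨hp1, hp2⟩ := hp
  set z : A := p * e + (1 - p) * (1 - e) with hz
  have hz1 : z - 1 = (2 • p - 1) * (e - p) := by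
    have : (2 • p - 1) * (e - p) = 2 • (p * e) - 2 • (p * p) - e + p := by noncomm_ring
    rw [this, hp2, hz]
    simp only [sub_mul, mul_sub, one_mul, mul_one, two_smul]
    abel
  have hzn : ‖z - 1‖ ≤ 3 * r := by
    rw [hz1]
    have h1 : ‖2 • p - 1‖ ≤ 3 := by
      calc ‖2 • p - 1‖ ≤ ‖2 • p‖ + ‖(1 : A)‖ := norm_sub_le _ _
        _ ≤ 2 * ‖p‖ + ‖(1 : A)‖ := by gcongr; rw [two_smul, two_mul]; exact norm_add_le _ _
        _ ≤ 3 := by linarith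
    calc _ ≤ ‖2 • p - 1‖ * ‖e - p‖ := norm_mul_le _ _
      _ ≤ 3 * r := by rw [norm_sub_rev e p]; gcongr
  have hznorm : ‖z‖ ≤ 1 + 3 * r := by
    calc ‖z‖ = ‖(z - 1) + 1‖ := by simp
      _ ≤ _ := (norm_add_le _ _).trans (by linarith)
  have hze : z * e = p * z := by
    have h1 : z * e = p * (e * e) + (1 - p) * (e - e * e) := by rw [hz]; noncomm_ring
    have h2 : p * z = (p * p) * e + (p - p * p) * (1 - e) := by rw [hz]; noncomm_ring
    rw [h1, h2, he2, hp2]; simp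
  have hze' : e * star z = star z * p := by
    have := congrArg star hze
    simpa [he1, hp1] using this
  set c : A := star z * z with hc
  have hcsa : IsSelfAdjoint c := IsSelfAdjoint.star_mul_self z
  have hcn : ‖c - 1‖ ≤ 9 * r := by
    have : c - 1 = star z * (z - 1) + star (z - 1) := by rw [hc]; simp [mul_sub]
    rw [this]
    calc _ ≤ ‖star z‖ * ‖z - 1‖ + ‖star (z - 1)‖ :=
          (norm_add_le _ _).trans (by gcongr; exact norm_mul_le _ _)
      _ = ‖z‖ * ‖z - 1‖ + ‖z - 1‖ := by rw [norm_star, norm_star]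
      _ ≤ (1 + 3 * r) * (3 * r) + 3 * r := by gcongr
      _ ≤ 9 * r := by nlinarith
  have hce : Commute c e := by
    change star z * z * e = e * (star z * z)
    rw [mul_assoc, hze, ← mul_assoc, ← mul_assoc, hze']
  have hspec : ∀ t ∈ spectrum ℝ c, |t - 1| ≤ 9 * r := by
    intro t ht
    have h1 : cfc (fun t : ℝ => t - 1) c = c - 1 := by
      rw [cfc_sub (fun t : ℝ => t) (fun _ : ℝ => 1) c, cfc_id' ℝ c, cfc_const_one ℝ c]
    have h2 := norm_apply_le_norm_cfc (fun t : ℝ => t - 1) c ht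
    rw [h1] at h2
    exact h2.trans hcn
  have hpos : ∀ t ∈ spectrum ℝ c, 1 / 2 ≤ t := by
    intro t ht
    have := abs_le.mp (hspec t ht)
    linarith
  set k : ℝ → ℝ := fun t => (√t)⁻¹ with hk
  have hkc : ContinuousOn k (spectrum ℝ c) := by
    refine ContinuousOn.inv₀ (Real.continuous_sqrt.continuousOn) fun t ht => ?_
    exact (Real.sqrt_pos.mpr (by linarith [hpos t ht])).ne'
  set q : A := cfc k c with hq
  have hqsa : star q = q := (cfc_predicate k c : IsSelfAdjoint _)
  have hqc : Commute q c := (Commute.refl c).cfc_real k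
  have hqe : Commute q e := hce.cfc_real k
  have hqqc : q * q * c = 1 := by
    have h1 : q * q * c = cfc (fun t => k t * k t * t) c := by
      rw [cfc_mul (fun t => k t * k t) (fun t : ℝ => t) c (hkc.mul hkc),
        cfc_mul k k c hkc hkc, cfc_id' ℝ c]
    rw [h1, ← cfc_const_one ℝ c]
    refine cfc_congr fun t ht => ?_
    have ht2 := hpos t ht
    have hs : 0 < √t := Real.sqrt_pos.mpr (by linarith)
    have hss : √t * √t = t := Real.mul_self_sqrt (by linarith)
    change (√t)⁻¹ * (√t)⁻¹ * t = 1
    rw [← mul_inv, hss]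
    exact inv_mul_cancel₀ (by linarith)
  have hqn : ‖q - 1‖ ≤ 9 * r := by
    have h1 : q - 1 = cfc (fun t => k t - 1) c := by
      rw [cfc_sub k (fun _ : ℝ => 1) c hkc, cfc_const_one ℝ c]
    rw [h1]
    refine norm_cfc_le (by linarith) fun t ht => ?_
    have ht2 := hpos t ht
    have hs : 0 < √t := Real.sqrt_pos.mpr (by linarith)
    have hss : √t * √t = t := Real.mul_self_sqrt (by linarith)
    have hs2 : 1 / 2 ≤ √t := Real.le_sqrt_of_sq_le (by linarith)
    have h3 : (k t - 1) * (√t + t) = 1 - t := by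
      change ((√t)⁻¹ - 1) * (√t + t) = 1 - t
      have h4 : (√t)⁻¹ * √t = 1 := inv_mul_cancel₀ hs.ne'
      have h5 : (√t)⁻¹ * t = √t := by
        nth_rewrite 2 [← hss]; rw [← mul_assoc, h4, one_mul]
      linear_combination h4 + h5
    have h6 : |k t - 1| * (√t + t) ≤ 9 * r := by
      rw [← abs_of_nonneg (show 0 ≤ √t + t by linarith), ← abs_mul, h3, abs_sub_comm]
      exact hspec t ht
    rw [Real.norm_eq_abs]
    nlinarith [abs_nonneg (k t - 1)]
  have hzu : IsUnit z := by
    have : z = 1 - (1 - z) := by simp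
    rw [this]
    apply isUnit_one_sub_of_norm_lt_one
    rw [norm_sub_rev]; linarith
  have hinv : z * (q * q * star z) = 1 := by
    have h1 : (q * q * star z) * z = 1 := by rw [mul_assoc]; exact hqqc
    obtain ⟨w, hw⟩ := hzu
    have h2 : q * q * star z = ↑w⁻¹ := by
      rw [← hw] at h1 ⊢
      exact Units.eq_inv_of_mul_eq_one_right h1
    rw [h2, ← hw]; simp
  refine ⟨z * q, ?_, ?_, ?_, ?_⟩
  · rw [star_mul, hqsa]
    calc q * star z * (z * q) = q * (c * q) := by rw [hc]; noncomm_ring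
      _ = q * q * c := by rw [← hqc.eq, mul_assoc]
      _ = 1 := hqqc
  · rw [star_mul, hqsa, ← hinv]; noncomm_ring
  · have : z * q - 1 = z * (q - 1) + (z - 1) := by noncomm_ring
    rw [this]
    calc _ ≤ ‖z‖ * ‖q - 1‖ + ‖z - 1‖ :=
          (norm_add_le _ _).trans (by gcongr; exact norm_mul_le _ _)
      _ ≤ (1 + 3 * r) * (9 * r) + 3 * r := by gcongr
      _ ≤ 40 * r := by nlinarith
  · rw [star_mul, hqsa]
    calc z * q * e * (q * star z) = z * (q * e) * q * star z := by noncomm_ring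
      _ = (z * e) * (q * q * star z) := by rw [hqe.eq]; noncomm_ring
      _ = p * (z * (q * q * star z)) := by rw [hze]; noncomm_ring
      _ = p := by rw [hinv, mul_one]

theorem exists_inv_proj {A : Type*} [CStarAlgebra A] {G : Type*} [Group G] [Fintype G]
    (α : G → A ≃⋆ₐ[ℂ] A)
    (hαmul : ∀ (g h : G) (a : A), α (g * h) a = α g (α h a)) (e : A) (he : IsProjection e)
    (η : ℝ) (hη : η < 1 / 16) (hinv : ∀ g, ‖α g e - e‖ ≤ η) :
    ∃ p : A, IsProjection p ∧ ‖p - e‖ ≤ 9 * η ∧ ∀ g, α g p = p := by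
  have hη0 : 0 ≤ η := (norm_nonneg _).trans (hinv 1)
  have hN : (0 : ℝ) < Fintype.card G := by exact_mod_cast Fintype.card_pos
  have hNC : (Fintype.card G : ℂ) ≠ 0 := by exact_mod_cast Fintype.card_ne_zero
  set f : A := (Fintype.card G : ℂ)⁻¹ • ∑ g, α g e with hf
  have hfsa : star f = f := by
    simp [hf, star_smul, star_sum, ← map_star, he.1]
  have hfinv : ∀ g, α g f = f := by
    intro g
    simp only [hf, map_smul, map_sum, ← hαmul]
    congr 1
    exact (Group.mulLeft_bijective g).sum_comp (fun h => α h e)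
  have hfe : ‖f - e‖ ≤ η := by
    have h1 : f - e = (Fintype.card G : ℂ)⁻¹ • ∑ g, (α g e - e) := by
      rw [Finset.sum_sub_distrib, smul_sub, ← hf, Finset.sum_const, Finset.card_univ,
        ← Nat.cast_smul_eq_nsmul ℂ, smul_smul, inv_mul_cancel₀ hNC, one_smul]
    rw [h1, norm_smul, norm_inv, Complex.norm_natCast, inv_mul_le_iff₀ hN]
    calc _ ≤ ∑ g, ‖α g e - e‖ := norm_sum_le _ _
      _ ≤ ∑ _g : G, η := Finset.sum_le_sum fun g _ => hinv g
      _ = _ := by simp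
  have hen := proj_norm_le he
  have hfn : ‖f‖ ≤ 1 + η := by
    calc ‖f‖ = ‖(f - e) + e‖ := by simp
      _ ≤ _ := (norm_add_le _ _).trans (by linarith)
  have hff : ‖f * f - f‖ ≤ 4 * η := by
    have h1 : f * f - f = f * (f - e) + (f - e) * e - (f - e) := by
      have : f * (f - e) + (f - e) * e - (f - e) = f * f - e * e - f + e := by noncomm_ring
      rw [this, he.2]; noncomm_ring
    rw [h1]
    calc _ ≤ ‖f‖ * ‖f - e‖ + ‖f - e‖ * ‖e‖ + ‖f - e‖ :=
          (norm_sub_le _ _).trans (add_le_add_left ((norm_add_le _ _).trans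
            (add_le_add (norm_mul_le _ _) (norm_mul_le _ _))) _)
      _ ≤ (1 + η) * η + η * 1 + η := by gcongr
      _ ≤ 4 * η := by nlinarith
  obtain ⟨p, hp, hpf, hpi⟩ := exists_proj_near f hfsa (4 * η) (by linarith) hff
  refine ⟨p, hp, ?_, fun g => hpi _ (hfinv g)⟩
  calc ‖p - e‖ = ‖(p - f) + (f - e)‖ := by simp
    _ ≤ _ := (norm_add_le _ _).trans (by linarith)


/-- the weak tracial Rokhlin property is equivalent to the formally stronger
version in which the defect projection `1 - e` is required to be invariant. -/
theorem stmt14 {A : Type*} [CStarAlgebra A] (hdim : ¬ FiniteDimensional ℂ A)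
    {G : Type*} [Group G] [Fintype G]
    (α : G → A ≃⋆ₐ[ℂ] A)
    (hα1 : ∀ a : A, α 1 a = a)
    (hαmul : ∀ (g h : G) (a : A), α (g * h) a = α g (α h a)) :
    WeakTracialRokhlin α ↔
      (∀ (F : Finset A) (ε : ℝ), 0 < ε →
        ∀ b : A, IsPositiveElem b → ‖b‖ = 1 →
        ∀ x : A, IsPositiveElem x → IsFull x →
        ∃ e : G → A, (∀ g, IsProjection (e g)) ∧
          (∀ g h, g ≠ h → e g * e h = 0) ∧
          (∀ g h, ‖α g (e h) - e (g * h)‖ < ε) ∧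
          (∀ g, ∀ a ∈ F, ‖e g * a - a * e g‖ < ε) ∧
          (∀ g, α g (∑ h, e h) = ∑ h, e h) ∧
          ProjSubEquiv (1 - ∑ g, e g) x ∧
          ‖(∑ g, e g) * b * (∑ g, e g)‖ > 1 - ε) := by
  constructor
  swap
  · intro H F ε hε b hb hb1 x hx hxf
    obtain ⟨e, h1, h2, h3, h4, -, h6, h7⟩ := H F ε hε b hb hb1 x hx hxf
    exact ⟨e, h1, h2, h3, h4, h6, h7⟩
  intro H F ε hε b hb hb1 x hx hxf
  have hN : (1 : ℝ) ≤ Fintype.card G := by exact_mod_cast Fintype.card_pos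
  set N : ℝ := (Fintype.card G : ℝ) with hNdef
  set M : ℝ := 1 + ∑ a ∈ F, ‖a‖ with hMdef
  have hM : 1 ≤ M := by
    have : 0 ≤ ∑ a ∈ F, ‖a‖ := Finset.sum_nonneg fun a _ => norm_nonneg a
    linarith
  have hFM : ∀ a ∈ F, ‖a‖ ≤ M := by
    intro a ha
    have := Finset.single_le_sum (f := fun a : A => ‖a‖) (fun a _ => norm_nonneg a) ha
    linarith
  set ε₀ : ℝ := min ε 1 with hε₀
  have hε₀pos : 0 < ε₀ := lt_min hε one_pos
  have hε₀1 : ε₀ ≤ 1 := min_le_right _ _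
  have hε₀ε : ε₀ ≤ ε := min_le_left _ _
  set δ : ℝ := ε₀ / (4000 * N * M) with hδ
  have hδpos : 0 < δ := by positivity
  set η : ℝ := N * δ with hηdef
  have hηM : η * M = ε₀ / 4000 := by rw [hηdef, hδ]; field_simp
  have hηpos : 0 < η := by positivity
  have hδη : δ ≤ η := by rw [hηdef]; nlinarith
  have hηs : η ≤ ε₀ / 4000 := by rw [← hηM]; nlinarith
  obtain ⟨e, hproj, horth, hact, hcomm, hsub, hnorm⟩ := H F δ hδpos b hb hb1 x hx hxf
  set E : A := ∑ g, e g with hE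
  have hEproj : IsProjection E := by
    constructor
    · rw [hE, star_sum]; exact Finset.sum_congr rfl fun g _ => (hproj g).1
    · rw [hE, Finset.sum_mul_sum]
      refine Finset.sum_congr rfl fun g _ => ?_
      rw [Finset.sum_eq_single g]
      · exact (hproj g).2
      · intro h _ hh; exact horth g h hh.symm
      · intro hg; exact absurd (Finset.mem_univ g) hg
  have hEinv : ∀ g, ‖α g E - E‖ ≤ η := by
    intro g
    have h1 : α g E - E = ∑ h, (α g (e h) - e (g * h)) := by
      rw [Finset.sum_sub_distrib, (Group.mulLeft_bijective g).sum_comp e, hE, map_sum]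
    rw [h1]
    calc _ ≤ ∑ h, ‖α g (e h) - e (g * h)‖ := norm_sum_le _ _
      _ ≤ ∑ _h : G, δ := Finset.sum_le_sum fun h _ => (hact g h).le
      _ = η := by simp [hηdef, hNdef]
  obtain ⟨p, hp, hpE, hpinv⟩ := exists_inv_proj α hαmul E hEproj η (by linarith) hEinv
  obtain ⟨u, hu1, hu2, hun, huE⟩ :=
    exists_unitary_near E p hEproj hp (9 * η) (by linarith) hpE
  have hunorm : ‖u‖ ≤ 1 := by
    have h1 : ‖star u * u‖ = ‖u‖ * ‖u‖ := CStarRing.norm_star_mul_self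
    rw [hu1] at h1
    have h2 : ‖(1 : A)‖ ≤ 1 := proj_norm_le ⟨star_one A, one_mul 1⟩
    nlinarith [norm_nonneg u]
  have hclose : ∀ g, ‖u * e g * star u - e g‖ ≤ 720 * η := by
    intro g
    have h1 : u * e g * star u - e g = (u - 1) * e g * star u + e g * star (u - 1) := by
      rw [star_sub, star_one]; noncomm_ring
    have h2 := proj_norm_le (hproj g)
    rw [h1]
    calc _ ≤ ‖u - 1‖ * ‖e g‖ * ‖star u‖ + ‖e g‖ * ‖star (u - 1)‖ :=
          (norm_add_le _ _).trans (add_le_add (norm_mul₃_le) (norm_mul_le _ _))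
      _ = ‖u - 1‖ * ‖e g‖ * ‖u‖ + ‖e g‖ * ‖u - 1‖ := by rw [norm_star, norm_star]
      _ ≤ (40 * (9 * η)) * 1 * 1 + 1 * (40 * (9 * η)) := by gcongr
      _ = 720 * η := by ring
  have hsum : ∑ g, u * e g * star u = p := by
    rw [← Finset.sum_mul, ← Finset.mul_sum]; exact huE
  have hmul : ∀ g h, (u * e g * star u) * (u * e h * star u) = u * (e g * e h) * star u := by
    intro g h
    calc _ = u * e g * (star u * u) * e h * star u := by noncomm_ring
      _ = _ := by rw [hu1]; noncomm_ring
  refine ⟨fun g => u * e g * star u, ?_, ?_, ?_, ?_, ?_, ?_, ?_⟩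
  · intro g
    refine ⟨?_, ?_⟩
    · simp only [star_mul, star_star, (hproj g).1, mul_assoc]
    · simp only [hmul, (hproj g).2]
  · intro g h hgh
    simp only [hmul, horth g h hgh, mul_zero, zero_mul]
  · intro g h
    have h1 : α g (u * e h * star u) - u * e (g * h) * star u
        = α g (u * e h * star u - e h) + (α g (e h) - e (g * h))
          - (u * e (g * h) * star u - e (g * h)) := by
      rw [map_sub]; abel
    have h2 : ‖α g (u * e h * star u - e h)‖ ≤ 720 * η := by
      rw [NonUnitalStarAlgHom.norm_map (α g) (α g).injective]; exact hclose h
    change ‖α g (u * e h * star u) - u * e (g * h) * star u‖ < ε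
    rw [h1]
    have h3 := hact g h
    have h4 := hclose (g * h)
    have h5 := norm_sub_le (α g (u * e h * star u - e h) + (α g (e h) - e (g * h)))
      (u * e (g * h) * star u - e (g * h))
    have h6 := norm_add_le (α g (u * e h * star u - e h)) (α g (e h) - e (g * h))
    linarith
  · intro g a ha
    change ‖u * e g * star u * a - a * (u * e g * star u)‖ < ε
    set d : A := u * e g * star u - e g with hd
    have h1 : u * e g * star u * a - a * (u * e g * star u)
        = (d * a - a * d) + (e g * a - a * e g) := by rw [hd]; noncomm_ring
    rw [h1]
    have h2 : ‖d * a - a * d‖ ≤ 1440 * (η * M) := by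
      have hdn : ‖d‖ ≤ 720 * η := hclose g
      calc _ ≤ ‖d‖ * ‖a‖ + ‖a‖ * ‖d‖ :=
            (norm_sub_le _ _).trans (add_le_add (norm_mul_le _ _) (norm_mul_le _ _))
        _ ≤ (720 * η) * M + M * (720 * η) := by
            have := hFM a ha
            gcongr
        _ = _ := by ring
    have h3 := hcomm g a ha
    have h4 := norm_add_le (d * a - a * d) (e g * a - a * e g)
    linarith
  · intro g
    simp only [hsum]
    exact hpinv g
  · simp only [hsum]
    obtain ⟨v, hv1, hv2⟩ := hsub
    refine ⟨u * v, ?_, ?_⟩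
    · rw [star_mul]
      calc u * v * (star v * star u) = u * (v * star v) * star u := by noncomm_ring
        _ = u * star u - u * E * star u := by rw [hv1]; noncomm_ring
        _ = 1 - p := by rw [hu2, huE]
    · have : star (u * v) * (u * v) = star v * v := by
        rw [star_mul]
        calc star v * star u * (u * v) = star v * (star u * u) * v := by noncomm_ring
          _ = _ := by rw [hu1, mul_one]
      rw [this]; exact hv2
  · simp only [hsum]
    have h1 : E * b * E = p * b * p - ((p - E) * b * p + E * b * (p - E)) := by noncomm_ring
    have h2 : ‖(p - E) * b * p + E * b * (p - E)‖ ≤ 18 * η := by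
      have hpn := proj_norm_le hp
      have hEn := proj_norm_le hEproj
      calc _ ≤ ‖p - E‖ * ‖b‖ * ‖p‖ + ‖E‖ * ‖b‖ * ‖p - E‖ :=
            (norm_add_le _ _).trans (add_le_add norm_mul₃_le norm_mul₃_le)
        _ ≤ (9 * η) * 1 * 1 + 1 * 1 * (9 * η) := by
            rw [hb1]; gcongr
        _ = 18 * η := by ring
    rw [h1] at hnorm
    have h3 := norm_sub_le (p * b * p) ((p - E) * b * p + E * b * (p - E))
    linarith
end

section
/- Let A be a unital C*-algebra over ℂ, G a finite group, and α : G → Aut(A) an action by *-automorphisms with the weak tracial Rokhlin property. Suppose A is α-simple, i.e. every closed two-sided ideal I of A with α_g(I) = I for all g ∈ G satisfies I = {0} or I = A. Then either A has Property (SP) or α has the strict Rokhlin property. -/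
section Helpers
variable {A : Type*} [CStarAlgebra A]

/-- No nonzero projection in `Her a`. -/
def NoProj (a : A) : Prop := ∀ p ∈ Her a, IsProjection p → p = 0

theorem her_sub (b m : A) : Her (b * m * b) ⊆ Her b := by
  apply closure_mono
  rintro _ ⟨a, rfl⟩
  exact ⟨m * b * a * b * m, by noncomm_ring⟩

theorem her_sub_sq (b : A) : Her (b * b) ⊆ Her b := by
  have := her_sub b (1 : A)
  simpa using this

theorem her_left {x w : A} (h : ∀ a, x * a * x * w = 0) {u : A} (hu : u ∈ Her x) :
    u * w = 0 := by
  have hc : IsClosed {u : A | u * w = 0} :=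
    isClosed_eq (by fun_prop) continuous_const
  refine (closure_minimal ?_ hc) hu
  rintro _ ⟨a, rfl⟩
  exact h a

theorem her_orth {x y : A} (hxy : ∀ u, x * u * y = 0) {u v : A}
    (hu : u ∈ Her x) (hv : v ∈ Her y) : u * v = 0 := by
  have hc : IsClosed {v : A | u * v = 0} :=
    isClosed_eq (by fun_prop) continuous_const
  refine (closure_minimal ?_ hc) hv
  rintro _ ⟨a, rfl⟩
  refine her_left (fun b => ?_) hu
  have := hxy (b * x)
  calc x * b * x * (y * a * y) = (x * (b * x) * y) * a * y := by noncomm_ring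
    _ = 0 := by rw [this]; simp

theorem her_star {x : A} (hx : star x = x) {u : A} (hu : u ∈ Her x) : star u ∈ Her x := by
  refine map_mem_closure (f := fun z : A => star z) continuous_star hu ?_
  rintro _ ⟨a, rfl⟩
  exact ⟨star a, by simp [hx, mul_assoc]⟩

theorem norm_le_of_orth {u v : A} (h : star u * v = 0) : ‖u‖ ≤ ‖u + v‖ := by
  have h1 : star u * (u + v) = star u * u := by rw [mul_add, h, add_zero]
  have h2 : ‖u‖ * ‖u‖ ≤ ‖u‖ * ‖u + v‖ := by
    rw [← CStarRing.norm_star_mul_self, ← h1]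
    exact (norm_mul_le _ _).trans (by rw [norm_star])
  by_contra hlt
  push Not at hlt
  nlinarith [norm_nonneg u, norm_nonneg (u + v)]

theorem noProj_add {x y : A} (hx : star x = x) (hy : star y = y)
    (hxy : ∀ u, x * u * y = 0) (hyx : ∀ u, y * u * x = 0)
    (nx : NoProj x) (ny : NoProj y) : NoProj (x + y) := by
  intro p hp hproj
  obtain ⟨s, hs, hlim⟩ := mem_closure_iff_seq_limit.1 hp
  choose a ha using hs
  have hdec : ∀ c, (x + y) * c * (x + y) = x * c * x + y * c * y := by
    intro c
    calc (x + y) * c * (x + y) = x * c * x + y * c * y + x * c * y + y * c * x := by noncomm_ring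
      _ = _ := by rw [hxy, hyx]; simp
  have hmem : ∀ (z c : A), z * c * z ∈ Her z := fun z c => subset_closure ⟨c, rfl⟩
  have hbx : ∀ c, ‖x * c * x‖ ≤ ‖(x + y) * c * (x + y)‖ := by
    intro c
    rw [hdec]
    exact norm_le_of_orth (her_orth hxy (her_star hx (hmem x c)) (hmem y c))
  have hcs : CauchySeq s := hlim.cauchySeq
  have hcx : CauchySeq (fun n => x * a n * x) := by
    rw [Metric.cauchySeq_iff] at hcs ⊢
    intro ε hε
    obtain ⟨N, hN⟩ := hcs ε hε
    refine ⟨N, fun m hm n hn => lt_of_le_of_lt ?_ (hN m hm n hn)⟩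
    rw [dist_eq_norm, dist_eq_norm, ha, ha]
    have := hbx (a m - a n)
    simpa [mul_sub, sub_mul] using this
  obtain ⟨u, hu⟩ := cauchySeq_tendsto_of_complete hcx
  have huH : u ∈ Her x := mem_closure_of_tendsto hu (Filter.Eventually.of_forall fun n => ⟨a n, rfl⟩)
  have hv : Filter.Tendsto (fun n => y * a n * y) Filter.atTop (nhds (p - u)) := by
    have := hlim.sub hu
    refine this.congr fun n => ?_
    rw [ha, hdec]; abel
  have hvH : p - u ∈ Her y :=
    mem_closure_of_tendsto hv (Filter.Eventually.of_forall fun n => ⟨a n, rfl⟩)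
  obtain ⟨v, hvdef⟩ : ∃ v, v = p - u := ⟨_, rfl⟩
  rw [← hvdef] at hvH
  have hp' : p = u + v := by rw [hvdef]; abel
  have huS := her_star hx huH
  have hvS := her_star hy hvH
  have e1 := her_orth hxy huH hvH
  have e2 := her_orth hxy huS hvH
  have e3 := her_orth hxy huH hvS
  have e4 := her_orth hxy huS hvS
  have e1' := her_orth hyx hvH huH
  obtain ⟨hps, hpp⟩ := hproj
  rw [hp'] at hps hpp
  rw [star_add] at hps
  have su : star u = u := by
    have hd : star u - u = v - star v := by
      rw [sub_eq_sub_iff_add_eq_add, hps]; abel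
    have f1 : u * (star u - u) = 0 := by rw [hd, mul_sub, e1, e3, sub_zero]
    have f2 : star u * (star u - u) = 0 := by rw [hd, mul_sub, e2, e4, sub_zero]
    have : star (star u - u) * (star u - u) = 0 := by
      rw [star_sub, star_star, sub_mul, f1, f2, sub_zero]
    exact sub_eq_zero.1 (CStarRing.star_mul_self_eq_zero_iff _ |>.1 this)
  have sv : star v = v := by
    rw [su] at hps; exact add_left_cancel hps
  have hsum : u * u + v * v = u + v := by
    rw [← hpp]
    calc u * u + v * v = u * u + v * v + 0 + 0 := by simp
      _ = u * u + v * v + u * v + v * u := by rw [e1, e1']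
      _ = _ := by noncomm_ring
  have hd : u * u - u = v - v * v := by
    rw [sub_eq_sub_iff_add_eq_add, hsum]; abel
  have iu : u * u = u := by
    have : star (u * u - u) * (u * u - u) = 0 := by
      rw [star_sub, star_mul, su]
      nth_rewrite 2 [hd]
      calc (u * u - u) * (v - v * v) = u * (u * v) - u * v - u * (u * v) * v + (u * v) * v := by
            noncomm_ring
        _ = 0 := by rw [e1]; simp
    exact sub_eq_zero.1 (CStarRing.star_mul_self_eq_zero_iff _ |>.1 this)
  have iv : v * v = v := by
    rw [iu] at hsum; exact add_left_cancel hsum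
  rw [hp', nx u huH ⟨su, iu⟩, ny v hvH ⟨sv, iv⟩, add_zero]

theorem noProj_zero : NoProj (0 : A) := by
  intro p hp _
  have : p * 1 = 0 := her_left (x := (0 : A)) (by simp) hp
  simpa using this

theorem noProj_sum {ι : Type*} [DecidableEq ι] (S : Finset ι) (b : ι → A)
    (hs : ∀ i, star (b i) = b i) (hn : ∀ i, NoProj (b i))
    (ho : ∀ i ∈ S, ∀ j ∈ S, i ≠ j → ∀ u, b i * u * b j = 0) :
    NoProj (∑ i ∈ S, b i) := by
  induction S using Finset.induction_on with
  | empty => simpa using noProj_zero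
  | insert i S hi ih =>
    rw [Finset.sum_insert hi]
    refine noProj_add (hs i) (by simp [star_sum, hs]) ?_ ?_ (hn i)
      (ih fun j hj k hk => ho j (Finset.mem_insert_of_mem hj) k (Finset.mem_insert_of_mem hk))
    · intro u
      rw [Finset.mul_sum]
      refine Finset.sum_eq_zero fun j hj => ?_
      exact ho i (Finset.mem_insert_self _ _) j (Finset.mem_insert_of_mem hj)
        (fun h => hi (h ▸ hj)) u
    · intro u
      rw [Finset.sum_mul, Finset.sum_mul]
      refine Finset.sum_eq_zero fun j hj => ?_
      exact ho j (Finset.mem_insert_of_mem hj) i (Finset.mem_insert_self _ _)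
        (fun h => hi (h ▸ hj)) u

theorem map_cont (φ : A ≃⋆ₐ[ℂ] A) : Continuous φ :=
  (StarAlgEquiv.isometry φ).continuous

theorem noProj_map (φ ψ : A ≃⋆ₐ[ℂ] A) (h1 : ∀ a, ψ (φ a) = a) (h2 : ∀ a, φ (ψ a) = a) {b : A}
    (hb : NoProj b) : NoProj (φ b) := by
  intro p hp hproj
  have : ψ p = 0 := by
    refine hb _ ?_ ⟨by rw [← map_star, hproj.1], by rw [← map_mul, hproj.2]⟩
    refine map_mem_closure (map_cont ψ) hp ?_
    rintro _ ⟨a, rfl⟩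
    exact ⟨ψ a, by simp [h1]⟩
  rw [← h2 p, this, map_zero]

theorem cancel_sq {z b : A} (hb : star b = b) (h : z * b * b = 0) : z * b = 0 := by
  have : z * b * star (z * b) = 0 := by
    rw [star_mul, hb]
    calc z * b * (b * star z) = z * b * b * star z := by noncomm_ring
      _ = 0 := by rw [h, zero_mul]
  exact (CStarRing.mul_star_self_eq_zero_iff _).1 this

theorem proj_of_subequiv {q x : A} (hq : q * q = q) (hq' : star q = q) (hx : NoProj x)
    (h : ProjSubEquiv q x) : q = 0 := by
  obtain ⟨v, hv, hm⟩ := h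
  have hqv : q * v - v = 0 := by
    refine (CStarRing.mul_star_self_eq_zero_iff _).1 ?_
    rw [star_sub, star_mul, hq']
    calc (q * v - v) * (star v * q - star v)
        = q * (v * star v) * q - q * (v * star v) - (v * star v) * q + v * star v := by
          noncomm_ring
      _ = 0 := by rw [hv, hq, hq]; abel
  have hz := hx _ hm ⟨by simp, by
    calc star v * v * (star v * v) = star v * ((v * star v) * v) := by noncomm_ring
      _ = star v * v := by rw [hv, sub_eq_zero.1 hqv]⟩
  have := (CStarRing.star_mul_self_eq_zero_iff _).1 hz
  rw [← hv, this, zero_mul]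

variable {G : Type*} [Group G] [Fintype G]

theorem exists_full [Nontrivial A] (α : G → A ≃⋆ₐ[ℂ] A)
    (hα1 : ∀ a : A, α 1 a = a)
    (hαmul : ∀ (g h : G) (a : A), α (g * h) a = α g (α h a))
    (hαsimple : ∀ I : TwoSidedIdeal A, IsClosed (I : Set A) →
      (∀ g : G, ∀ a ∈ I, α g a ∈ I) →
      (∀ x ∈ I, x = (0 : A)) ∨ (∀ x : A, x ∈ I))
    (a : A) (ha : star a = a) (ha0 : a ≠ 0) (hna : NoProj a) :
    ∃ x : A, star x = x ∧ NoProj x ∧ IsFull (x * x) := by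
  classical
  have inv1 : ∀ g a, α g⁻¹ (α g a) = a := fun g a => by rw [← hαmul, inv_mul_cancel, hα1]
  have inv2 : ∀ g a, α g (α g⁻¹ a) = a := fun g a => by rw [← hαmul, mul_inv_cancel, hα1]
  let P : Finset G → Prop := fun S => ∃ b : A, star b = b ∧ b ≠ 0 ∧ NoProj b ∧
    ∀ g ∈ S, ∀ h ∈ S, g ≠ h → ∀ u, α g b * u * α h b = 0
  have hPe : ({S | P S} : Set (Finset G)).Nonempty := ⟨∅, a, ha, ha0, hna, by simp⟩
  obtain ⟨S, hS⟩ := (Set.toFinite {S | P S}).exists_maximal hPe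
  obtain ⟨⟨b, hb, hb0, hnb, hort⟩, hmax⟩ := hS
  have hbg : ∀ g, star (α g b) = α g b := fun g => by rw [← map_star, hb]
  refine ⟨∑ g ∈ S, α g b, by simp [star_sum, hbg],
    noProj_sum S _ hbg (fun g => noProj_map _ _ (inv1 g) (inv2 g) hnb) hort, ?_⟩
  intro I hI hxI
  -- `α h b ^ 3` is in `I`
  have hcube : ∀ h ∈ S, α h b * α h b * α h b ∈ I := by
    intro h hh
    have hx : (∑ g ∈ S, α g b) * α h b = α h b * α h b := by
      rw [Finset.sum_mul, Finset.sum_eq_single h]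
      · intro g hg hne
        simpa using hort g hg h hh hne 1
      · intro hn; exact absurd hh hn
    have h3 := I.mul_mem_right _ (α h b) hxI
    rwa [mul_assoc, hx, ← mul_assoc, hx] at h3
  have hess : ∀ y : A, (∀ z ∈ I, y * z = 0) → y = 0 := by
    intro y hy
    have hyS : ∀ h ∈ S, ∀ u, y * u * α h b = 0 := by
      intro h hh u
      have h3 := hy _ (I.mul_mem_left u _ (hcube h hh))
      apply cancel_sq (hbg h)
      apply cancel_sq (hbg h)
      rw [← h3]; noncomm_ring
    have hyk : ∀ k u, y * u * α k b = 0 := by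
      intro k u
      by_contra hne
      have hkS : k ∉ S := fun hk => hne (hyS k hk u)
      obtain ⟨w, hw⟩ : ∃ w, w = α k⁻¹ (y * u) := ⟨_, rfl⟩
      have hαw : α k w = y * u := by rw [hw, inv2]
      have hwb : w * b ≠ 0 := by
        intro h0
        apply hne
        rw [← hαw, ← map_mul, h0, map_zero]
      have hc0 : b * (star w * w) * b ≠ 0 := by
        intro h0
        apply hwb
        refine (CStarRing.star_mul_self_eq_zero_iff _).1 ?_
        rw [star_mul, hb, ← h0]; noncomm_ring
      have key : ∀ h ∈ S, ∀ t, α k (b * (star w * w) * b) * t * α h (b * (star w * w) * b) = 0 := by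
        intro h hh t
        have := hyS h hh (u * α k b * t)
        simp only [map_mul, hαw]
        calc α k b * (α k (star w) * (y * u)) * α k b * t * (α h b * (α h (star w) * α h w) * α h b)
            = α k b * α k (star w) * (y * (u * α k b * t) * α h b) *
              ((α h (star w) * α h w) * α h b) := by noncomm_ring
          _ = 0 := by rw [this]; simp
      have hcs : star (b * (star w * w) * b) = b * (star w * w) * b := by
        simp [hb, mul_assoc]
      have hP : P (insert k S) := by
        refine ⟨b * (star w * w) * b, hcs, hc0, fun p hp => hnb p (her_sub _ _ hp), ?_⟩
        intro g hg h hh hgh t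
        rcases Finset.mem_insert.1 hg with rfl | hg2 <;>
          rcases Finset.mem_insert.1 hh with rfl | hh2
        · exact absurd rfl hgh
        · exact key h hh2 t
        · have := congrArg star (key g hg2 (star t))
          simpa only [star_mul, ← map_star, hb, star_star, star_zero, ← mul_assoc] using this
        · simp only [map_mul]
          have := hort g hg2 h hh2 hgh t
          calc α g b * (α g (star w) * α g w) * α g b * t *
                (α h b * (α h (star w) * α h w) * α h b)
              = α g b * (α g (star w) * α g w) * (α g b * t * α h b) *
                ((α h (star w) * α h w) * α h b) := by noncomm_ring
            _ = 0 := by rw [this]; simp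
      exact hkS (hmax hP (Finset.subset_insert k S) (Finset.mem_insert_self k S))
    let K : TwoSidedIdeal A := TwoSidedIdeal.mk' {z | ∀ k u, y * u * α k z = 0}
      (by simp)
      (by intro p q hp hq k u; rw [map_add, mul_add, hp, hq, add_zero])
      (by intro p hp k u; rw [map_neg, mul_neg, hp, neg_zero])
      (by intro p q hq k u; rw [map_mul, ← mul_assoc, mul_assoc y, hq])
      (by intro p q hp k u; rw [map_mul, ← mul_assoc, hp, zero_mul])
    have hK : ∀ z, z ∈ K ↔ ∀ k u, y * u * α k z = 0 := fun z => by
      simp [K, TwoSidedIdeal.mem_mk']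
    have hKc : IsClosed (K : Set A) := by
      have : (K : Set A) = ⋂ k, ⋂ u, {z | y * u * α k z = 0} := by
        ext z; simp [hK]
      rw [this]
      refine isClosed_iInter fun k => isClosed_iInter fun u =>
        isClosed_eq (continuous_const.mul (map_cont _)) continuous_const
    rcases hαsimple K hKc (fun g z hz => by
      rw [hK] at hz ⊢
      intro k u
      rw [← hαmul]; exact hz _ _) with h | h
    · exact absurd (h b ((hK b).2 hyk)) hb0
    · have := (hK 1).1 (h 1) 1 1
      simpa using this
  let J : TwoSidedIdeal A := TwoSidedIdeal.mk' {z | ∀ g, α g z ∈ I}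
      (by simp [I.zero_mem])
      (by intro p q hp hq k; rw [map_add]; exact I.add_mem (hp k) (hq k))
      (by intro p hp k; rw [map_neg]; exact I.neg_mem (hp k))
      (by intro p q hq k; rw [map_mul]; exact I.mul_mem_left _ _ (hq k))
      (by intro p q hp k; rw [map_mul]; exact I.mul_mem_right _ _ (hp k))
  have hJ : ∀ z, z ∈ J ↔ ∀ g, α g z ∈ I := fun z => by
    simp [J, TwoSidedIdeal.mem_mk']
  have hJc : IsClosed (J : Set A) := by
    have : (J : Set A) = ⋂ g, (α g) ⁻¹' (I : Set A) := by
      ext z; simp [hJ]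
    rw [this]
    exact isClosed_iInter fun g => hI.preimage (map_cont _)
  rcases hαsimple J hJc (fun g z hz => by
      rw [hJ] at hz ⊢
      intro k
      rw [← hαmul]; exact hz _) with h | h
  · exfalso
    have hprod : ∀ T : Finset G, ∃ z : A, z ≠ 0 ∧ ∀ g ∈ T, α g z ∈ I := by
      intro T
      induction T using Finset.induction_on with
      | empty => exact ⟨1, one_ne_zero, by simp⟩
      | insert g T _ ih =>
        obtain ⟨z, hz0, hz⟩ := ih
        have h1 : α g z ≠ 0 := by
          intro h0
          apply hz0
          rw [← inv1 g z, h0, map_zero]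
        obtain ⟨w, hw, hw0⟩ : ∃ w ∈ I, α g z * w ≠ 0 := by
          by_contra hcon
          push Not at hcon
          exact h1 (hess _ hcon)
        refine ⟨z * α g⁻¹ w, ?_, ?_⟩
        · intro h0
          apply hw0
          have := congrArg (α g) h0
          rwa [map_mul, inv2, map_zero] at this
        · intro k hk
          rw [map_mul]
          rcases Finset.mem_insert.1 hk with rfl | hk
          · rw [inv2]; exact I.mul_mem_left _ _ hw
          · exact I.mul_mem_right _ _ (hz k hk)
    obtain ⟨z, hz0, hz⟩ := hprod Finset.univ
    exact hz0 (h z ((hJ z).2 fun g => hz g (Finset.mem_univ g)))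
  · intro c
    have := (hJ c).1 (h c) 1
    rwa [hα1] at this

end Helpers

/-- if an action with the weak tracial Rokhlin property is α-simple, then
either the algebra has Property (SP) or the action has the strict Rokhlin property. -/
theorem stmt15 {A : Type*} [CStarAlgebra A]
    {G : Type*} [Group G] [Fintype G]
    (α : G → A ≃⋆ₐ[ℂ] A)
    (hα1 : ∀ a : A, α 1 a = a)
    (hαmul : ∀ (g h : G) (a : A), α (g * h) a = α g (α h a))
    (hRok : WeakTracialRokhlin α)
    (hαsimple : ∀ I : TwoSidedIdeal A, IsClosed (I : Set A) →
      (∀ g : G, ∀ a ∈ I, α g a ∈ I) →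
      (∀ x ∈ I, x = (0 : A)) ∨ (∀ x : A, x ∈ I)) :
    HasSP A ∨ StrictRokhlin α := by
  classical
  by_cases hSP : HasSP A
  · exact Or.inl hSP
  right
  unfold HasSP at hSP
  push Not at hSP
  obtain ⟨a, ⟨y, hy⟩, ha0, hna⟩ := hSP
  have : Nontrivial A := ⟨⟨a, 0, ha0⟩⟩
  obtain ⟨x, hxs, hxn, hxf⟩ := exists_full α hα1 hαmul hαsimple a (by simp [hy]) ha0 hna
  intro F ε hε
  obtain ⟨e, h1, h2, h3, h4, h5, -⟩ := hRok F ε hε 1 ⟨1, by simp⟩ norm_one (x * x)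
    ⟨x, by rw [hxs]⟩ hxf
  refine ⟨e, h1, h2, ?_, h3, h4⟩
  have hse : star (∑ g, e g) = ∑ g, e g := by simp [star_sum, (h1 _).1]
  have hee : (∑ g, e g) * (∑ g, e g) = ∑ g, e g := by
    rw [Finset.sum_mul]
    refine Finset.sum_congr rfl fun g _ => ?_
    rw [Finset.mul_sum, Finset.sum_eq_single g]
    · exact (h1 g).2
    · intro h _ hne
      exact h2 g h hne.symm
    · simp
  have := proj_of_subequiv (q := 1 - ∑ g, e g) (x := x * x)
    (by rw [mul_sub, sub_mul, sub_mul, hee]; simp) (by rw [star_sub, hse, star_one])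
    (fun p hp => hxn p (her_sub_sq _ hp)) h5
  exact (sub_eq_zero.1 this).symm
end
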